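/- arXiv:1706.03999 — 9 statements merged into one kernel-verified Lean document; each statement's English description precedes it below -/
import Mathlib

section
/- Let n ≥ 1 and let 𝒞 be a set of subsets of Fin n with ∅ ∈ 𝒞. Then 𝒞 is a connected code (i.e., there exist d ≥ 1 and sets U i ⊆ EuclideanSpace ℝ (Fin d), i ∈ Fin n, each closed and preconnected, with 𝒞 = 𝒞(U)) if and only if 𝒞 satisfies the chain condition: for every σ, τ ∈ 𝒞 and every i ∈ σ ∩ τ there exist m ≥ 1 and pairwise distinct codewords ν₁, …, ν_m ∈ 𝒞 such that ν₁ = σ, ν_m = τ, i ∈ ν_j for every j ∈ [m], and for every j ∈ [m−1] either ν_j ⊆ ν_{j+1} or ν_{j+1} ⊆ ν_j. -/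
/-- The receptive field code of a family of receptive fields
`U : Fin n → Set (EuclideanSpace ℝ (Fin d))`: the set of all codewords
`σ ⊆ Fin n` such that some stimulus `x` lies in exactly the fields `U i`, `i ∈ σ`. -/
def RFCode {n d : ℕ} (U : Fin n → Set (EuclideanSpace ℝ (Fin d))) : Set (Set (Fin n)) :=
  {σ | ∃ x : EuclideanSpace ℝ (Fin d), σ = {i | x ∈ U i}}

/-- The chain condition of Proposition 1: for every `σ, τ ∈ 𝒞` and `i ∈ σ ∩ τ` there is a
sequence of pairwise distinct codewords from `σ` to `τ`, all containing `i`, in which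
consecutive codewords are comparable by inclusion. -/
def ChainCondition {n : ℕ} (C : Set (Set (Fin n))) : Prop :=
  ∀ σ ∈ C, ∀ τ ∈ C, ∀ i ∈ σ ∩ τ,
    ∃ m : ℕ, ∃ hm : 1 ≤ m, ∃ ν : Fin m → Set (Fin n),
      Function.Injective ν ∧
      (∀ j, ν j ∈ C) ∧
      ν ⟨0, hm⟩ = σ ∧
      ν ⟨m - 1, by omega⟩ = τ ∧
      (∀ j, i ∈ ν j) ∧
      (∀ j : Fin m, ∀ h : j.1 + 1 < m, ν j ⊆ ν ⟨j.1 + 1, h⟩ ∨ ν ⟨j.1 + 1, h⟩ ⊆ ν j)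

theorem cc_forward {n d : ℕ} (U : Fin n → Set (EuclideanSpace ℝ (Fin d)))
    (hU : ∀ i, IsClosed (U i) ∧ IsPreconnected (U i)) : ChainCondition (RFCode U) := by
  classical
  rintro σ ⟨x, hx⟩ τ ⟨y, hy⟩ i ⟨hiσ, hiτ⟩
  let V := {ν : Set (Fin n) // ν ∈ RFCode U ∧ i ∈ ν}
  let G : SimpleGraph V := SimpleGraph.fromRel (fun a b => a.1 ⊆ b.1)
  let s : V := ⟨σ, ⟨x, hx⟩, hiσ⟩
  let t : V := ⟨τ, ⟨y, hy⟩, hiτ⟩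
  have hcmp : ∀ a b : V, a.1 ⊆ b.1 → G.Reachable a b := by
    intro a b hab
    by_cases h : a = b
    · subst h; exact SimpleGraph.Reachable.refl _
    · exact SimpleGraph.Adj.reachable ((SimpleGraph.fromRel_adj _ _ _).2 ⟨h, Or.inl hab⟩)
  have hnb : ∀ z : EuclideanSpace ℝ (Fin d), ∀ᶠ w in nhds z, {j | w ∈ U j} ⊆ {j | z ∈ U j} := by
    intro z
    have : ∀ᶠ w in nhds z, ∀ j, w ∈ U j → z ∈ U j := by
      rw [Filter.eventually_all]
      intro j
      by_cases hz : z ∈ U j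
      · exact Filter.Eventually.of_forall fun _ _ => hz
      · filter_upwards [(hU j).1.isOpen_compl.mem_nhds hz] with w hw h
        exact absurd h hw
    exact this
  let c : U i → V := fun z => ⟨{j | z.1 ∈ U j}, ⟨z.1, rfl⟩, z.2⟩
  have hloc : IsLocallyConstant (fun z : U i => G.Reachable s (c z)) := by
    rw [IsLocallyConstant.iff_eventually_eq]
    intro z
    have := continuous_subtype_val.continuousAt.eventually (hnb z.1)
    filter_upwards [this] with w hw
    have h := hcmp (c w) (c z) hw
    exact propext ⟨fun k => k.trans h, fun k => k.trans h.symm⟩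
  have : PreconnectedSpace (U i) := Subtype.preconnectedSpace (hU i).2
  have hxi : x ∈ U i := by rw [hx] at hiσ; exact hiσ
  have hyi : y ∈ U i := by rw [hy] at hiτ; exact hiτ
  have heq := hloc.apply_eq_of_preconnectedSpace ⟨x, hxi⟩ ⟨y, hyi⟩
  have h1 : c ⟨x, hxi⟩ = s := Subtype.ext hx.symm
  have h2 : c ⟨y, hyi⟩ = t := Subtype.ext hy.symm
  have hreach : G.Reachable s t := by
    simp only [h1, h2] at heq
    exact heq ▸ SimpleGraph.Reachable.refl _
  obtain ⟨p, hp⟩ := hreach.exists_isPath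
  refine ⟨p.length + 1, by omega, fun j => (p.getVert j).1, ?_, ?_, ?_, ?_, ?_, ?_⟩
  · intro a b hab
    exact Fin.ext (hp.getVert_injOn (show a.1 ≤ p.length by omega) (show b.1 ≤ p.length by omega)
      (Subtype.ext hab))
  · intro j; exact (p.getVert j).2.1
  · simp [s]
  · simp [t]
  · intro j; exact (p.getVert j).2.2
  · intro j h
    have := p.adj_getVert_succ (i := j.1) (by omega)
    exact ((SimpleGraph.fromRel_adj _ _ _).1 this).2

/-- The realization by subsets of the order complex of `C`. -/
def ccField {n d : ℕ} (C : Set (Set (Fin n))) (e : Fin d ≃ Set (Fin n)) (i : Fin n) :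
    Set (EuclideanSpace ℝ (Fin d)) :=
  {x | (∀ j, 0 ≤ x j) ∧ ∑ j, x j = 1 ∧ (∀ j, x j ≠ 0 → e j ∈ C ∧ i ∈ e j) ∧
    ∀ j k, x j ≠ 0 → x k ≠ 0 → e j ⊆ e k ∨ e k ⊆ e j}

theorem ccField_closed {n d : ℕ} (C : Set (Set (Fin n))) (e : Fin d ≃ Set (Fin n)) (i : Fin n) :
    IsClosed (ccField C e i) := by
  have hc : ∀ j : Fin d, Continuous fun x : EuclideanSpace ℝ (Fin d) => x j := by
    intro j; fun_prop
  have ho : ∀ j : Fin d, IsOpen {x : EuclideanSpace ℝ (Fin d) | x j ≠ 0} := fun j =>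
    isOpen_ne_fun (hc j) continuous_const
  unfold ccField
  refine IsClosed.and ?_ (IsClosed.and ?_ (IsClosed.and ?_ ?_))
  · simp only [Set.setOf_forall]
    exact isClosed_iInter fun j => isClosed_le continuous_const (hc j)
  · exact isClosed_eq (continuous_finset_sum _ fun j _ => hc j) continuous_const
  · simp only [Set.setOf_forall]
    exact isClosed_iInter fun j => isClosed_imp (ho j) isClosed_const
  · simp only [Set.setOf_forall]
    exact isClosed_iInter fun j => isClosed_iInter fun k => isClosed_imp (ho j)
      (isClosed_imp (ho k) isClosed_const)

theorem ccField_segment {n d : ℕ} {C : Set (Set (Fin n))} {e : Fin d ≃ Set (Fin n)} {i : Fin n}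
    {x y : EuclideanSpace ℝ (Fin d)} (hx : x ∈ ccField C e i) (hy : y ∈ ccField C e i)
    (h : ∀ j k, x j ≠ 0 → y k ≠ 0 → e j ⊆ e k ∨ e k ⊆ e j) :
    JoinedIn (ccField C e i) x y := by
  apply JoinedIn.of_segment_subset
  rintro z ⟨a, b, ha, hb, hab, rfl⟩
  have key : ∀ j, (a • x + b • y) j = a * x j + b * y j := fun j => by simp
  have hne : ∀ j, (a • x + b • y) j ≠ 0 → x j ≠ 0 ∨ y j ≠ 0 := by
    intro j hj
    by_contra! hcon
    apply hj
    rw [key, hcon.1, hcon.2]; simp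
  obtain ⟨x1, x2, x3, x4⟩ := hx
  obtain ⟨y1, y2, y3, y4⟩ := hy
  refine ⟨?_, ?_, ?_, ?_⟩
  · intro j; rw [key]
    exact add_nonneg (mul_nonneg ha (x1 j)) (mul_nonneg hb (y1 j))
  · simp only [key, Finset.sum_add_distrib, ← Finset.mul_sum, x2, y2]; linarith
  · intro j hj
    exact (hne j hj).elim (x3 j) (y3 j)
  · intro j k hj hk
    rcases hne j hj with hj | hj <;> rcases hne k hk with hk | hk
    · exact x4 j k hj hk
    · exact h j k hj hk
    · exact (h k j hk hj).symm
    · exact y4 j k hj hk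

theorem ccField_vertex {n d : ℕ} {C : Set (Set (Fin n))} {e : Fin d ≃ Set (Fin n)} {i : Fin n}
    {j : Fin d} (hj : e j ∈ C) : EuclideanSpace.single j (1 : ℝ) ∈ ccField C e i ↔ i ∈ e j := by
  constructor
  · rintro ⟨-, -, h, -⟩
    exact (h j (by simp)).2
  · intro hi
    have hs : ∀ k, EuclideanSpace.single j (1 : ℝ) k ≠ 0 → k = j := by
      intro k hk
      by_contra hkj
      exact hk (by simp [hkj])
    refine ⟨?_, ?_, ?_, ?_⟩
    · intro k
      by_cases h : k = j <;> simp [h]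
    · simp
    · intro k hk
      rw [hs k hk]; exact ⟨hj, hi⟩
    · intro k l hk hl
      rw [hs k hk, hs l hl]; exact Or.inl subset_rfl

theorem ccField_supp {n d : ℕ} {C : Set (Set (Fin n))} {e : Fin d ≃ Set (Fin n)} {i : Fin n}
    {x : EuclideanSpace ℝ (Fin d)} (hx : x ∈ ccField C e i) : ∃ j, x j ≠ 0 := by
  by_contra! h
  have := hx.2.1
  simp [h] at this

theorem single_supp {d : ℕ} {j k : Fin d} (hk : EuclideanSpace.single j (1 : ℝ) k ≠ 0) : k = j := by
  by_contra hkj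
  exact hk (by simp [hkj])

theorem ccField_preconn {n d : ℕ} {C : Set (Set (Fin n))} (e : Fin d ≃ Set (Fin n))
    (hC : ChainCondition C) (i : Fin n) : IsPreconnected (ccField C e i) := by
  have step : ∀ x ∈ ccField C e i, ∃ j, e j ∈ C ∧ i ∈ e j ∧
      JoinedIn (ccField C e i) x (EuclideanSpace.single j (1 : ℝ)) := by
    intro x hx
    obtain ⟨j, hj⟩ := ccField_supp hx
    obtain ⟨h1, h2⟩ := hx.2.2.1 j hj
    refine ⟨j, h1, h2, ccField_segment hx ((ccField_vertex h1).2 h2) ?_⟩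
    intro k l hk hl
    rw [single_supp hl]
    exact hx.2.2.2 k j hk hj
  apply isPreconnected_of_forall_pair
  intro x hx y hy
  obtain ⟨j, hjC, hij, hj⟩ := step x hx
  obtain ⟨k, hkC, hik, hk⟩ := step y hy
  have hjk : JoinedIn (ccField C e i) (EuclideanSpace.single j (1 : ℝ))
      (EuclideanSpace.single k (1 : ℝ)) := by
    obtain ⟨m, hm, ν, -, hνC, h0, h1, hi, hadj⟩ := hC _ hjC _ hkC i ⟨hij, hik⟩
    have ind : ∀ l, ∀ hl : l < m, JoinedIn (ccField C e i) (EuclideanSpace.single j (1 : ℝ))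
        (EuclideanSpace.single (e.symm (ν ⟨l, hl⟩)) (1 : ℝ)) := by
      intro l
      induction l with
      | zero =>
        intro hl
        rw [h0, Equiv.symm_apply_apply]
        exact JoinedIn.refl ((ccField_vertex hjC).2 hij)
      | succ l ih =>
        intro hl
        refine (ih (by omega)).trans (ccField_segment ?_ ?_ ?_)
        · exact (ccField_vertex (by simpa using hνC _)).2 (by simpa using hi _)
        · exact (ccField_vertex (by simpa using hνC _)).2 (by simpa using hi _)
        · intro a b ha hb
          rw [single_supp ha, single_supp hb]
          simpa using hadj ⟨l, by omega⟩ hl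
    have := ind (m - 1) (by omega)
    rwa [h1, Equiv.symm_apply_apply] at this
  obtain ⟨γ, hγ⟩ := (hj.trans hjk).trans hk.symm
  exact ⟨Set.range γ, Set.range_subset_iff.2 hγ, ⟨0, γ.source⟩, ⟨1, γ.target⟩,
    isPreconnected_range γ.continuous⟩

theorem ccField_code {n d : ℕ} {C : Set (Set (Fin n))} (e : Fin d ≃ Set (Fin n))
    (h0 : ∅ ∈ C) : C = RFCode (ccField C e) := by
  classical
  ext σ
  constructor
  · intro hσ
    refine ⟨EuclideanSpace.single (e.symm σ) 1, ?_⟩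
    ext i
    rw [Set.mem_setOf_eq, ccField_vertex (by simpa using hσ)]
    simp
  · rintro ⟨x, rfl⟩
    by_cases hne : ∃ i, x ∈ ccField C e i
    · obtain ⟨i, hx⟩ := hne
      obtain ⟨j₀, hj₀⟩ := ccField_supp hx
      obtain ⟨x1, x2, x3, x4⟩ := hx
      obtain ⟨ν, hν⟩ := Set.Finite.exists_minimal (s := {s | x (e.symm s) ≠ 0}) (Set.toFinite _)
        ⟨e j₀, by simpa using hj₀⟩
      have hmin : ∀ k, x k ≠ 0 → ν ⊆ e k := by
        intro k hk
        rcases x4 (e.symm ν) k hν.1 hk with h | h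
        · simpa using h
        · rw [Equiv.apply_symm_apply] at h
          exact hν.2 (y := e k) (by simpa using hk) h
      have hνC : ν ∈ C := by simpa using (x3 _ hν.1).1
      convert hνC
      ext k
      constructor
      · rintro ⟨-, -, h, -⟩
        simpa using (h _ hν.1).2
      · intro hk
        exact ⟨x1, x2, fun j hj => ⟨(x3 j hj).1, hmin j hj hk⟩, x4⟩
    · push Not at hne
      convert h0
      ext i
      simp [hne i]

/-- A code with `∅ ∈ 𝒞` is connected (realizable by closed preconnected sets in some
dimension `d ≥ 1`) if and only if it satisfies the chain condition. -/
theorem connected_iff_chainCondition {n : ℕ} (hn : 1 ≤ n)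
    (C : Set (Set (Fin n))) (hC : (∅ : Set (Fin n)) ∈ C) :
    (∃ d : ℕ, 1 ≤ d ∧ ∃ U : Fin n → Set (EuclideanSpace ℝ (Fin d)),
        (∀ i, IsClosed (U i) ∧ IsPreconnected (U i)) ∧ C = RFCode U) ↔
      ChainCondition C := by
  classical
  constructor
  · rintro ⟨d, -, U, hU, rfl⟩
    exact cc_forward U hU
  · intro h
    exact ⟨Fintype.card (Set (Fin n)), Fintype.card_pos, ccField C (Fintype.equivFin _).symm,
      fun i => ⟨ccField_closed _ _ _, ccField_preconn _ h i⟩, ccField_code _ hC⟩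
end

section
/- Let n, d ≥ 1 and let U : Fin n → Set (EuclideanSpace ℝ (Fin d)) be a family of sets each of which is closed and preconnected, and let 𝒞 = 𝒞(U) be its receptive field code. Then 𝒞 satisfies the chain condition: for every σ, τ ∈ 𝒞 and every i ∈ σ ∩ τ there exist m ≥ 1 and pairwise distinct codewords ν₁, …, ν_m ∈ 𝒞 such that ν₁ = σ, ν_m = τ, i ∈ ν_j for every j ∈ [m], and for every j ∈ [m−1] either ν_j ⊆ ν_{j+1} or ν_{j+1} ⊆ ν_j. -/
/-- The receptive field code of a family of closed preconnected sets satisfies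
the chain condition. -/
theorem chainCondition_of_closed_preconnected {n d : ℕ} (hn : 1 ≤ n) (hd : 1 ≤ d)
    (U : Fin n → Set (EuclideanSpace ℝ (Fin d)))
    (hU : ∀ i, IsClosed (U i) ∧ IsPreconnected (U i)) :
    ChainCondition (RFCode U) := by
  classical
  rintro σ ⟨x, hx⟩ τ ⟨y, hy⟩ i ⟨hiσ, hiτ⟩
  let V := {a : Set (Fin n) // a ∈ RFCode U ∧ i ∈ a}
  let G : SimpleGraph V := SimpleGraph.fromRel (fun a b => a.1 ⊆ b.1)
  let P : EuclideanSpace ℝ (Fin d) → EuclideanSpace ℝ (Fin d) → Prop := fun x y =>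
    ∀ (hx : x ∈ U i) (hy : y ∈ U i),
      G.Reachable ⟨{k | x ∈ U k}, ⟨x, rfl⟩, hx⟩ ⟨{k | y ∈ U k}, ⟨y, rfl⟩, hy⟩
  have hxi : x ∈ U i := by rw [hx] at hiσ; exact hiσ
  have hyi : y ∈ U i := by rw [hy] at hiτ; exact hiτ
  have key : ∀ x ∈ U i, ∀ᶠ y in nhdsWithin x (U i), P x y ∧ P y x := by
    intro x hx
    have h1 : ∀ᶠ y in nhds x, ∀ k, x ∉ U k → y ∉ U k := by
      rw [Filter.eventually_all]
      intro k
      by_cases hk : x ∈ U k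
      · exact Filter.Eventually.of_forall fun y h => absurd hk h
      · filter_upwards [(hU k).1.isOpen_compl.mem_nhds hk] with y hy _ using hy
    filter_upwards [mem_nhdsWithin_of_mem_nhds h1] with y hy
    have hr : P x y := by
      intro hx hy'
      by_cases he : ({k | x ∈ U k} : Set (Fin n)) = {k | y ∈ U k}
      · have : (⟨{k | x ∈ U k}, ⟨x, rfl⟩, hx⟩ : V) = ⟨{k | y ∈ U k}, ⟨y, rfl⟩, hy'⟩ :=
          Subtype.ext he
        rw [this]
      · apply SimpleGraph.Adj.reachable
        rw [SimpleGraph.fromRel_adj]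
        refine ⟨fun h => he (congrArg Subtype.val h), Or.inr ?_⟩
        intro k hk
        by_contra h
        exact hy k h hk
    exact ⟨hr, fun a b => (hr b a).symm⟩
  have hP : x ∈ U i ∧ y ∈ U i ∧ P x y := by
    refine (hU i).2.induction₂ (fun x y => x ∈ U i ∧ y ∈ U i ∧ P x y) ?_ ?_ ?_ hxi hyi
    · intro x hx
      filter_upwards [key x hx, self_mem_nhdsWithin] with y h hy using ⟨hx, hy, h.1⟩
    · rintro a b c - - - ⟨ha, hb, h1⟩ ⟨_, hc, h2⟩
      exact ⟨ha, hc, fun _ _ => (h1 ha hb).trans (h2 hb hc)⟩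
    · rintro a b - - ⟨ha, hb, h⟩
      exact ⟨hb, ha, fun _ _ => (h ha hb).symm⟩
  obtain ⟨p, hp⟩ := (hP.2.2 hxi hyi).exists_isPath
  refine ⟨p.length + 1, by omega, fun j => (p.getVert j.1).1, ?_, fun j => (p.getVert j.1).2.1,
    ?_, ?_, fun j => (p.getVert j.1).2.2, ?_⟩
  · intro a b hab
    have ha := a.2
    have hb := b.2
    exact Fin.ext (hp.getVert_injOn (show a.1 ≤ p.length by omega) (show b.1 ≤ p.length by omega)
      (Subtype.ext hab))
  · simp [hx]
  · simp [hy]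
  · intro j h
    have := p.adj_getVert_succ (i := j.1) (by omega)
    rw [SimpleGraph.fromRel_adj] at this
    exact this.2
end

section
/- Let n ≥ 1 and let 𝒞 be a set of subsets of Fin n with ∅ ∈ 𝒞 that satisfies the chain condition: for every σ, τ ∈ 𝒞 and every i ∈ σ ∩ τ there exist m ≥ 1 and pairwise distinct codewords ν₁, …, ν_m ∈ 𝒞 such that ν₁ = σ, ν_m = τ, i ∈ ν_j for every j ∈ [m], and for every j ∈ [m−1] either ν_j ⊆ ν_{j+1} or ν_{j+1} ⊆ ν_j. Then there exists a family U : Fin n → Set (EuclideanSpace ℝ (Fin 3)) of closed preconnected sets with 𝒞 = 𝒞(U). -/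
noncomputable section AuxArc

open Relation

variable {n : ℕ}

def auxF (σ : Set (Fin n)) : ℝ := ((Fintype.equivFin (Set (Fin n)) σ : ℕ) : ℝ)

def auxE (p : Set (Fin n) × Set (Fin n)) : ℝ :=
  ((Fintype.equivFin (Set (Fin n) × Set (Fin n)) p : ℕ) : ℝ)

theorem auxF_inj {σ τ : Set (Fin n)} (h : auxF σ = auxF τ) : σ = τ := by
  unfold auxF at h
  exact (Fintype.equivFin _).injective (Fin.ext (Nat.cast_injective h))

theorem auxE_inj {σ τ : Set (Fin n) × Set (Fin n)} (h : auxE σ = auxE τ) : σ = τ := by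
  unfold auxE at h
  exact (Fintype.equivFin _).injective (Fin.ext (Nat.cast_injective h))

def auxP (p : Set (Fin n) × Set (Fin n)) (t : ℝ) : EuclideanSpace ℝ (Fin 3) :=
  WithLp.toLp 2 ![(1 - t) * auxF p.1 + t * auxF p.2, t * (1 - t), auxE p * (t * (1 - t))]

open Classical in
def auxLab (p : Set (Fin n) × Set (Fin n)) (t : ℝ) : Set (Fin n) :=
  if t = 1 then p.2 else p.1

theorem auxP_cont (p : Set (Fin n) × Set (Fin n)) : Continuous (auxP p) := by
  unfold auxP
  refine (PiLp.continuous_toLp 2 _).comp ?_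
  refine continuous_pi fun i => ?_
  fin_cases i <;> simp <;> fun_prop

theorem auxP_lab {p q : Set (Fin n) × Set (Fin n)} {t s : ℝ}
    (ht : t ∈ Set.Icc (0 : ℝ) 1) (hs : s ∈ Set.Icc (0 : ℝ) 1)
    (h : auxP p t = auxP q s) : auxLab p t = auxLab q s := by
  have h0 : (1 - t) * auxF p.1 + t * auxF p.2 = (1 - s) * auxF q.1 + s * auxF q.2 :=
    congrArg (fun v : EuclideanSpace ℝ (Fin 3) => v 0) h
  have h1 : t * (1 - t) = s * (1 - s) :=
    congrArg (fun v : EuclideanSpace ℝ (Fin 3) => v 1) h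
  have h2 : auxE p * (t * (1 - t)) = auxE q * (s * (1 - s)) :=
    congrArg (fun v : EuclideanSpace ℝ (Fin 3) => v 2) h
  by_cases hz : t * (1 - t) = 0
  · have hz' : s * (1 - s) = 0 := by rw [← h1]; exact hz
    apply auxF_inj
    have e1 : t = 0 ∨ t = 1 := by
      rcases mul_eq_zero.1 hz with h | h
      · exact Or.inl h
      · right; linarith
    have e2 : s = 0 ∨ s = 1 := by
      rcases mul_eq_zero.1 hz' with h | h
      · exact Or.inl h
      · right; linarith
    rcases e1 with rfl | rfl <;> rcases e2 with rfl | rfl <;> simpa [auxLab] using h0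
  · rw [← h1] at h2
    have hpq : p = q := auxE_inj (mul_right_cancel₀ hz h2)
    have t1 : t ≠ 1 := by rintro rfl; simp at hz
    have s1 : s ≠ 1 := by rintro rfl; simp at h1; exact hz (by simpa using h1)
    simp [auxLab, t1, s1, hpq]

def auxArc (p : Set (Fin n) × Set (Fin n)) : Set (EuclideanSpace ℝ (Fin 3)) :=
  auxP p '' Set.Icc (0 : ℝ) 1

def auxI (C : Set (Set (Fin n))) (i : Fin n) : Set (Set (Fin n) × Set (Fin n)) :=
  {p | p.1 ∈ C ∧ p.2 ∈ C ∧ p.1 ⊆ p.2 ∧ i ∈ p.1}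

def auxU (C : Set (Set (Fin n))) (i : Fin n) : Set (EuclideanSpace ℝ (Fin 3)) :=
  ⋃ p : auxI C i, auxArc p.1

theorem auxP_zero (σ τ : Set (Fin n)) : auxP (σ, τ) 0 = auxP (σ, σ) 0 := by
  simp [auxP]

theorem auxP_one (σ τ : Set (Fin n)) : auxP (σ, τ) 1 = auxP (τ, τ) 0 := by
  simp [auxP]

theorem auxArc_zero (σ τ : Set (Fin n)) : auxP (σ, σ) 0 ∈ auxArc (σ, τ) :=
  ⟨0, by simp, auxP_zero σ τ⟩

theorem auxArc_one (σ τ : Set (Fin n)) : auxP (τ, τ) 0 ∈ auxArc (σ, τ) :=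
  ⟨1, by simp, auxP_one σ τ⟩

theorem auxU_code (C : Set (Set (Fin n))) {p : Set (Fin n) × Set (Fin n)} {t : ℝ}
    (h1 : p.1 ∈ C) (h2 : p.2 ∈ C) (h3 : p.1 ⊆ p.2) (ht : t ∈ Set.Icc (0 : ℝ) 1) :
    {i | auxP p t ∈ auxU C i} = auxLab p t := by
  ext i
  simp only [Set.mem_setOf_eq, auxU, Set.mem_iUnion]
  constructor
  · rintro ⟨⟨q, hq1, hq2, hq3, hq4⟩, s, hs, hqs⟩
    rw [← auxP_lab hs ht hqs]
    unfold auxLab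
    split_ifs
    · exact hq3 hq4
    · exact hq4
  · intro hi
    unfold auxLab at hi
    split_ifs at hi with h
    · subst h
      refine ⟨⟨(p.2, p.2), h2, h2, subset_rfl, hi⟩, ?_⟩
      rw [show auxP p 1 = _ from auxP_one p.1 p.2]
      exact auxArc_zero _ _
    · exact ⟨⟨p, h1, h2, h3, hi⟩, t, ht, rfl⟩

theorem auxU_closed (C : Set (Set (Fin n))) (i : Fin n) : IsClosed (auxU C i) := by
  unfold auxU
  refine isClosed_iUnion_of_finite fun p => ?_
  exact (isCompact_Icc.image (auxP_cont _)).isClosed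

theorem auxU_conn (C : Set (Set (Fin n))) (hchain : ChainCondition C) (i : Fin n) :
    IsPreconnected (auxU C i) := by
  unfold auxU
  have symm : Std.Symm (fun p q : auxI C i => (auxArc p.1 ∩ auxArc q.1).Nonempty) :=
    ⟨fun p q h => by rwa [Set.inter_comm]⟩
  refine IsPreconnected.iUnion_of_reflTransGen
    (fun p => isPreconnected_Icc.image _ (auxP_cont _).continuousOn) ?_
  rintro ⟨⟨σ, σ'⟩, a1, a2, a3, a4⟩ ⟨⟨τ, τ'⟩, b1, b2, b3, b4⟩
  dsimp only at a1 a2 a3 a4 b1 b2 b3 b4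
  obtain ⟨m, hm, ν, -, hνC, hν0, hν1, hνi, hν⟩ := hchain σ a1 τ b1 i ⟨a4, b4⟩
  have key : ∀ k (hk : k < m), ReflTransGen
      (fun p q : auxI C i => (auxArc p.1 ∩ auxArc q.1).Nonempty)
      ⟨(σ, σ), a1, a1, subset_rfl, a4⟩
      ⟨(ν ⟨k, hk⟩, ν ⟨k, hk⟩), hνC _, hνC _, subset_rfl, hνi _⟩ := by
    intro k
    induction k with
    | zero =>
      intro hk
      subst hν0
      exact ReflTransGen.refl
    | succ k ih =>
      intro hk
      refine (ih (by omega)).trans ?_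
      rcases hν ⟨k, by omega⟩ hk with h | h
      · refine ReflTransGen.head (b := ⟨(ν ⟨k, by omega⟩, ν ⟨k + 1, hk⟩),
          hνC _, hνC _, h, hνi _⟩) ?_ (ReflTransGen.single ?_)
        · exact ⟨_, auxArc_zero _ _, auxArc_zero _ _⟩
        · exact ⟨_, auxArc_one _ _, auxArc_zero _ _⟩
      · refine ReflTransGen.head (b := ⟨(ν ⟨k + 1, hk⟩, ν ⟨k, by omega⟩),
          hνC _, hνC _, h, hνi _⟩) ?_ (ReflTransGen.single ?_)
        · exact ⟨_, auxArc_zero _ _, auxArc_one _ _⟩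
        · exact ⟨_, auxArc_zero _ _, auxArc_zero _ _⟩
  have hk := key (m - 1) (by omega)
  subst hν1
  refine ReflTransGen.head ?_ (hk.tail ?_)
  · exact ⟨_, auxArc_zero _ _, auxArc_zero _ _⟩
  · exact ⟨_, auxArc_zero _ _, auxArc_zero _ _⟩

end AuxArc

/-- Every code containing `∅` and satisfying the chain condition is realizable by
closed preconnected sets in dimension `3`. -/
theorem realizable_dim3_closed_of_chainCondition {n : ℕ} (hn : 1 ≤ n)
    (C : Set (Set (Fin n))) (hC : (∅ : Set (Fin n)) ∈ C) (hchain : ChainCondition C) :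
    ∃ U : Fin n → Set (EuclideanSpace ℝ (Fin 3)),
      (∀ i, IsClosed (U i) ∧ IsPreconnected (U i)) ∧ C = RFCode U := by
  refine ⟨auxU C, fun i => ⟨auxU_closed C i, auxU_conn C hchain i⟩, ?_⟩
  ext σ
  constructor
  · intro hσ
    refine ⟨auxP (σ, σ) 0, ?_⟩
    rw [auxU_code C hσ hσ subset_rfl (by simp)]
    simp [auxLab]
  · rintro ⟨x, rfl⟩
    by_cases hx : ∃ i, x ∈ auxU C i
    · obtain ⟨i, hi⟩ := hx
      obtain ⟨⟨p, h1, h2, h3, h4⟩, t, ht, rfl⟩ := Set.mem_iUnion.1 hi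
      rw [auxU_code C h1 h2 h3 ht]
      unfold auxLab
      split_ifs
      · exact h2
      · exact h1
    · push Not at hx
      have : {i | x ∈ auxU C i} = ∅ := by
        ext i; simp [hx i]
      rw [this]; exact hC
end

section
/- Let n ≥ 1 and let 𝒞 be a connected code on n neurons, i.e., there exist d ≥ 1 and a family U : Fin n → Set (EuclideanSpace ℝ (Fin d)) of closed preconnected sets with 𝒞 = 𝒞(U). Then 𝒞 is realizable by closed preconnected sets in dimension 3: there exists a family V : Fin n → Set (EuclideanSpace ℝ (Fin 3)) of closed preconnected sets with 𝒞 = 𝒞(V). In particular, the minimal embedding dimension of a connected code with respect to the family of connected sets is at most 3. -/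
namespace CC
open Relation

section words
variable {X : Type*} (A : X → X → Prop)

def Mv (w : ℕ → X) (s : ℕ) (u : X) : Prop := A (w s) u ∧ A (w (s+1)) u ∧ A (w (s+2)) u

def PathW (w : ℕ → X) : Prop := ∀ k, A (w k) (w (k+1))

def St (a b : ℕ) (w w' : ℕ → X) : Prop :=
  ∃ s u, a ≤ s ∧ s + 1 < b ∧ Mv A w s u ∧ w' = Function.update w (s+1) u

def HomIn (a b : ℕ) : (ℕ → X) → (ℕ → X) → Prop := ReflTransGen (St A a b)

variable {A}

theorem HomIn.mono {a b a' b' : ℕ} {w w' : ℕ → X} (h : HomIn A a b w w') (ha : a' ≤ a)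
    (hb : b ≤ b') : HomIn A a' b' w w' := by
  refine ReflTransGen.mono ?_ _ _ h
  rintro x y ⟨s, u, h1, h2, h3, h4⟩
  exact ⟨s, u, by omega, by omega, h3, h4⟩

theorem HomIn.eq_out {a b : ℕ} {w w' : ℕ → X} (h : HomIn A a b w w') :
    ∀ t, (t ≤ a ∨ b ≤ t) → w' t = w t := by
  induction h with
  | refl => intros; rfl
  | tail _ h2 ih =>
    obtain ⟨s, u, h1, h2, h3, rfl⟩ := h2
    intro t ht
    rw [Function.update_of_ne (by omega), ih t ht]

theorem path_update (hs : ∀ x y, A x y → A y x) {w : ℕ → X} (hw : PathW A w) {s : ℕ} {u : X}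
    (h : Mv A w s u) : PathW A (Function.update w (s+1) u) := by
  intro k
  by_cases h1 : k = s + 1
  · subst h1
    rw [Function.update_self, Function.update_of_ne (by omega)]
    exact hs _ _ h.2.2
  · rw [Function.update_of_ne h1]
    by_cases h2 : k = s
    · subst h2
      rw [Function.update_self]; exact h.1
    · rw [Function.update_of_ne (by omega)]; exact hw k

theorem HomIn.path (hs : ∀ x y, A x y → A y x) {a b : ℕ} {w w' : ℕ → X} (h : HomIn A a b w w')
    (hw : PathW A w) : PathW A w' := by
  induction h with
  | refl => exact hw
  | tail _ h2 ih =>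
    obtain ⟨s, u, h1, h2, h3, rfl⟩ := h2
    exact path_update hs ih h3

theorem HomIn.symm (hs : ∀ x y, A x y → A y x) {a b : ℕ} {w w' : ℕ → X} (h : HomIn A a b w w')
    (hw : PathW A w) : HomIn A a b w' w := by
  induction h with
  | refl => exact ReflTransGen.refl
  | tail h1 h2 ih =>
    rename_i y z
    have hp : PathW A y := HomIn.path hs h1 hw
    obtain ⟨s, u, h1, h2, h3, rfl⟩ := h2
    refine ReflTransGen.head ?_ ih
    refine ⟨s, y (s+1), h1, h2, ⟨?_, ?_, ?_⟩, ?_⟩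
    · rw [Function.update_of_ne (by omega)]; exact hp s
    · rw [Function.update_self]; exact hs _ _ h3.2.1
    · rw [Function.update_of_ne (by omega)]; exact hs _ _ (hp (s+1))
    · simp

/-- moving a homotopy to another place -/
theorem HomIn.shift {K : ℕ} {p q : ℕ → X} (h : HomIn A 0 K p q) (b : ℕ) (w : ℕ → X)
    (hw : ∀ k ≤ K, w (b + k) = p k) :
    ∃ w', HomIn A b (b+K) w w' ∧ ∀ k ≤ K, w' (b+k) = q k := by
  induction h with
  | refl => exact ⟨w, ReflTransGen.refl, hw⟩
  | tail h1 h2 ih =>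
    obtain ⟨w', h3, h4⟩ := ih
    obtain ⟨s, u, h5, h6, h7, rfl⟩ := h2
    refine ⟨Function.update w' (b+s+1) u, h3.tail ⟨b+s, u, by omega, by omega, ⟨?_, ?_, ?_⟩, rfl⟩, ?_⟩
    · rw [h4 s (by omega)]; exact h7.1
    · rw [add_assoc, h4 (s+1) (by omega)]; exact h7.2.1
    · rw [add_assoc, h4 (s+2) (by omega)]; exact h7.2.2
    · intro k hk
      by_cases hks : k = s+1
      · subst hks; rw [← add_assoc, Function.update_self, Function.update_self]
      · rw [Function.update_of_ne (by omega), Function.update_of_ne hks, h4 k hk]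

theorem run_change (hr : ∀ x, A x x) (n : ℕ) : ∀ (s : ℕ) (w : ℕ → X) (a a' : X), A a a' →
    w s = a' → w (s+n+1) = a' → (∀ k, s < k → k ≤ s + n → w k = a) →
    ∃ w', HomIn A s (s+n+1) w w' ∧ ∀ k, s ≤ k → k ≤ s+n+1 → w' k = a' := by
  induction n with
  | zero =>
    intro s w a a' _ h1 h2 _
    refine ⟨w, ReflTransGen.refl, fun k hk hk' => ?_⟩
    obtain rfl | rfl : k = s ∨ k = s + 1 := by omega
    · exact h1
    · exact h2
  | succ n ih =>
    intro s w a a' haa h1 h2 h3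
    have hm : Mv A w s a' := by
      refine ⟨by rw [h1]; exact hr _, by rw [h3 (s+1) (by omega) (by omega)]; exact haa, ?_⟩
      by_cases hn : n = 0
      · subst hn
        rw [show s + 2 = s + (0+1) + 1 by omega, h2]; exact hr _
      · rw [h3 (s+2) (by omega) (by omega)]; exact haa
    obtain ⟨w', h4, h5⟩ := ih (s+1) (Function.update w (s+1) a') a a' haa (by simp)
      (by rw [Function.update_of_ne (by omega), ← h2]; congr 1; omega)
      (by intro k hk hk'; rw [Function.update_of_ne (by omega)]; exact h3 k (by omega) (by omega))
    refine ⟨w', ReflTransGen.head ⟨s, a', le_rfl, by omega, hm, rfl⟩ (h4.mono (by omega) (by omega)), ?_⟩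
    intro k hk hk'
    by_cases hks : k = s
    · subst hks
      rw [h4.eq_out k (by omega), Function.update_of_ne (by omega), h1]
    · exact h5 k (by omega) (by omega)

theorem fold_pal (hr : ∀ x, A x x) (hs : ∀ x y, A x y → A y x) (L : ℕ) : ∀ (s : ℕ) (w : ℕ → X), PathW A w →
    (∀ k ≤ L, w (s+k) = w (s+L-k)) →
    ∃ w', HomIn A s (s+L) w w' ∧ ∀ k, s ≤ k → k ≤ s+L → w' k = w s := by
  induction L using Nat.strong_induction_on with
  | _ L ih =>
    intro s w hw hp
    rcases L with _ | _ | L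
    · exact ⟨w, ReflTransGen.refl, fun k h1 h2 => by congr 1; omega⟩
    · refine ⟨w, ReflTransGen.refl, fun k h1 h2 => ?_⟩
      obtain rfl | rfl : k = s ∨ k = s + 1 := by omega
      · rfl
      · have := hp 1 (by omega); simpa using this
    · obtain ⟨w1, h1, h2⟩ := ih L (by omega) (s+1) w hw (by
        intro k hk
        have := hp (k+1) (by omega)
        rw [show s + 1 + k = s + (k+1) by omega, this]; congr 1; omega)
      obtain ⟨w2, h3, h4⟩ := run_change hr (L+1) s w1 (w (s+1)) (w s) (hs _ _ (hw s))
        (h1.eq_out s (by omega))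
        (by
          rw [h1.eq_out _ (by omega)]
          have := hp 0 (by omega)
          simp only [add_zero, Nat.sub_zero] at this
          rw [this]; congr 1)
        (by intro k hk hk'; exact h2 k (by omega) (by omega))
      refine ⟨w2, (h1.mono (by omega) (by omega)).trans (h3.mono (by omega) (by omega)), ?_⟩
      intro k hk hk'
      exact h4 k hk (by omega)

end words

section cls
variable {X : Type*} {A : X → X → Prop}

def trunc (f : ℕ → X) (N : ℕ) (o : X) : ℕ → X := fun k => if k ≤ N then f k else o

theorem HomIn.trunc {b : ℕ} {f g : ℕ → X} (h : HomIn A 0 b f g) (o : X) (N : ℕ) (hN : b ≤ N) :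
    HomIn A 0 b (trunc f N o) (trunc g N o) := by
  induction h with
  | refl => exact ReflTransGen.refl
  | tail h1 h2 ih =>
    obtain ⟨s, u, h5, h6, h7, rfl⟩ := h2
    refine ih.tail ⟨s, u, h5, h6, ?_, ?_⟩
    · unfold CC.trunc Mv; beta_reduce
      refine ⟨?_, ?_, ?_⟩
      · rw [if_pos (by omega)]; exact h7.1
      · rw [if_pos (by omega)]; exact h7.2.1
      · rw [if_pos (by omega)]; exact h7.2.2
    · funext k
      unfold CC.trunc
      by_cases hk : k = s+1
      · subst hk; rw [if_pos (by omega)]; simp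
      · rw [Function.update_of_ne hk, Function.update_of_ne hk]

def Hom (A : X → X → Prop) (f g : ℕ → X) : Prop := ∃ b, HomIn A 0 b f g

theorem Hom.refl (f : ℕ → X) : Hom A f f := ⟨0, ReflTransGen.refl⟩
theorem Hom.trans {f g h : ℕ → X} (h1 : Hom A f g) (h2 : Hom A g h) : Hom A f h := by
  obtain ⟨b, h1⟩ := h1
  obtain ⟨b', h2⟩ := h2
  exact ⟨max b b', (h1.mono le_rfl (le_max_left _ _)).trans (h2.mono le_rfl (le_max_right _ _))⟩

theorem Hom.single {f : ℕ → X} (s : ℕ) (u : X) (h : Mv A f s u) :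
    Hom A f (Function.update f (s+1) u) :=
  ⟨s+2, ReflTransGen.single ⟨s, u, by omega, by omega, h, rfl⟩⟩

theorem Hom.symm (hs : ∀ x y, A x y → A y x) {f g : ℕ → X} (h : Hom A f g) (hf : PathW A f) : Hom A g f :=
  ⟨_, h.choose_spec.symm hs hf⟩

theorem trunc_shift (hr : ∀ x, A x x) (hs : ∀ x y, A x y → A y x)
    {f : ℕ → X} {K : ℕ} {a o : X} (hK : ∀ k ≥ K, f k = a) (h : A a o)
    (N : ℕ) (hN : K ≤ N) : Hom A (trunc f K o) (trunc f N o) := by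
  induction N, hN using Nat.le_induction with
  | base => exact Hom.refl _
  | succ N hN ih =>
    refine ih.trans ?_
    convert Hom.single (f := trunc f N o) N a ?_ using 1
    · funext k
      unfold trunc
      by_cases hk : k = N + 1
      · subst hk; simp [hK (N+1) (by omega)]
      · rw [Function.update_of_ne hk]
        split_ifs <;> first | rfl | omega
    · unfold trunc Mv; beta_reduce
      rw [if_pos le_rfl, if_neg (by omega), if_neg (by omega), hK N hN]
      exact ⟨hr _, hs _ _ h, hs _ _ h⟩

variable (A) in
structure Wd (x0 o : X) where
  f : ℕ → X
  K : ℕ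
  path : PathW A f
  h0 : f 0 = x0
  hK : ∀ k ≥ K, f k = o

theorem path_trunc (hr : ∀ x, A x x) {f : ℕ → X} {K : ℕ} {o : X} (hf : PathW A f)
    (h : A (f K) o) : PathW A (trunc f K o) := by
  intro k
  unfold trunc
  by_cases h1 : k + 1 ≤ K
  · rw [if_pos (by omega), if_pos h1]; exact hf k
  · by_cases h2 : k = K
    · subst h2; simpa using h
    · rw [if_neg (by omega), if_neg (by omega)]; exact hr _

def Wd.ext (hr : ∀ x, A x x) {x0 a o : X} (w : Wd A x0 a) (h : A a o) : Wd A x0 o where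
  f := trunc w.f w.K o
  K := w.K + 1
  path := path_trunc hr w.path (by rw [w.hK _ le_rfl]; exact h)
  h0 := by simp [trunc, w.h0]
  hK := by intro k hk; unfold trunc; rw [if_neg (by omega)]

def WdSet (hs : ∀ x y, A x y → A y x) (x0 o : X) : Setoid (Wd A x0 o) where
  r w w' := Hom A w.f w'.f
  iseqv := ⟨fun _ => Hom.refl _, fun {x _} h => h.symm hs x.path, fun h h' => h.trans h'⟩

def Cls (hs : ∀ x y, A x y → A y x) (x0 o : X) := Quotient (WdSet hs x0 o)

theorem ext_congr (hr : ∀ x, A x x) (hs : ∀ x y, A x y → A y x) {x0 a o : X} (w w' : Wd A x0 a)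
    (h : A a o) (hh : Hom A w.f w'.f) : Hom A (w.ext hr h).f (w'.ext hr h).f := by
  obtain ⟨b, hb⟩ := hh
  let N := max b (max w.K w'.K)
  have h1 := trunc_shift hr hs w.hK h N (by simp [N])
  have h2 := trunc_shift hr hs w'.hK h N (by simp [N])
  have h3 : Hom A (trunc w.f N o) (trunc w'.f N o) := ⟨b, hb.trunc o N (by simp [N])⟩
  exact h1.trans (h3.trans (h2.symm hs (w'.ext hr h).path))

def tr (hr : ∀ x, A x x) (hs : ∀ x y, A x y → A y x) {x0 : X} (a o : X) (h : A a o) :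
    Cls hs x0 a → Cls hs x0 o :=
  Quotient.map (fun w => w.ext hr h) (fun w w' hh => ext_congr hr hs w w' h hh)

theorem tr_back (hr : ∀ x, A x x) (hs : ∀ x y, A x y → A y x) {x0 : X} (a o : X) (h : A a o)
    (h' : A o a) (x : Cls hs x0 a) : tr hr hs o a h' (tr hr hs a o h x) = x := by
  induction x using Quotient.inductionOn with
  | _ w =>
  refine Quotient.sound ?_
  change Hom A (trunc (trunc w.f w.K o) (w.K+1) a) w.f
  convert Hom.single (f := trunc (trunc w.f w.K o) (w.K+1) a) w.K a ?_ using 1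
  · funext k
    by_cases hk : k = w.K+1
    · subst hk; simp [w.hK]
    · rw [Function.update_of_ne hk]
      unfold trunc
      split_ifs with h1 h2
      · rfl
      · omega
      · exact w.hK _ (by omega)
  · unfold trunc Mv
    simp [hr, h', w.hK _ le_rfl]

theorem tr_tri (hr : ∀ x, A x x) (hs : ∀ x y, A x y → A y x) {x0 : X} (a b c : X) (h : A a b)
    (h' : A b c) (h'' : A a c) (x : Cls hs x0 a) :
    tr hr hs b c h' (tr hr hs a b h x) = tr hr hs a c h'' x := by
  induction x using Quotient.inductionOn with
  | _ w =>
  refine Quotient.sound ?_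
  change Hom A (trunc (trunc w.f w.K b) (w.K+1) c) (trunc w.f w.K c)
  convert Hom.single (f := trunc (trunc w.f w.K b) (w.K+1) c) w.K c ?_ using 1
  · funext k
    by_cases hk : k = w.K+1
    · subst hk; simp [trunc]
    · rw [Function.update_of_ne hk]
      unfold trunc
      split_ifs with h1 h2 <;> first | rfl | omega
  · unfold trunc Mv
    simp [hr, h', h'', w.hK _ le_rfl]

def pre (f : ℕ → X) (k : ℕ) : ℕ → X := fun t => f (min t k)

def preW (hr : ∀ x, A x x) {f : ℕ → X} (hf : PathW A f) (k : ℕ) : Wd A (f 0) (f k) where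
  f := pre f k
  K := k
  path := by
    intro t
    unfold pre
    by_cases h : t + 1 ≤ k
    · rw [min_eq_left (by omega), min_eq_left h]; exact hf t
    · rw [min_eq_right (by omega), min_eq_right (by omega)]; exact hr _
  h0 := by simp [pre]
  hK := by intro t ht; simp [pre, ht]

theorem tr_pre (hr : ∀ x, A x x) (hs : ∀ x y, A x y → A y x) {f : ℕ → X} (hf : PathW A f) (k : ℕ) :
    tr hr hs _ _ (hf k) (Quotient.mk (WdSet hs (f 0) (f k)) (preW hr hf k)) =
      Quotient.mk (WdSet hs (f 0) (f (k+1))) (preW hr hf (k+1)) := by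
  refine Quotient.sound ?_
  change Hom A (trunc (pre f k) k (f (k+1))) (pre f (k+1))
  have : trunc (pre f k) k (f (k+1)) = pre f (k+1) := by
    funext t
    unfold trunc pre
    split_ifs with h
    · rw [min_eq_left h, min_eq_left (by omega)]
    · rw [min_eq_right (by omega)]
  rw [this]; exact Hom.refl _
end cls
section ls
open Topology

structure LocSys {X : Type*} (A : X → X → Prop) where
  S : X → Type*
  tr : ∀ a b, A a b → S a → S b
  back : ∀ a b (h : A a b) (h' : A b a) x, tr b a h' (tr a b h x) = x
  tri : ∀ a b c (h : A a b) (h' : A b c) (h'' : A a c) x, tr b c h' (tr a b h x) = tr a c h'' x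

set_option linter.unusedSectionVars false
variable {X E : Type*} [TopologicalSpace E] (O : X → Set E)

abbrev Adj (a b : X) : Prop := O a ⊆ O b ∨ O b ⊆ O a

theorem adj_refl (a : X) : Adj O a a := Or.inl subset_rfl
theorem adj_symm (a b : X) (h : Adj O a b) : Adj O b a := Or.symm h

variable (F : LocSys (Adj O))

structure Sec (K : Set E) where
  v : ∀ a, (O a ∩ K).Nonempty → F.S a
  compat : ∀ a b ha hb (h : O a ⊆ O b), F.tr a b (Or.inl h) (v a ha) = v b hb

def Good (K : Set E) : Prop := ∀ a (ha : (O a ∩ K).Nonempty) (x : F.S a), ∃ σ : Sec O F K, σ.v a ha = x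

variable {O F}

theorem Sec.compat' {K : Set E} (σ : Sec O F K) (a b ha hb) (h : O b ⊆ O a) :
    F.tr a b (Or.inr h) (σ.v a ha) = σ.v b hb := by
  rw [← σ.compat b a hb ha h, F.back]

def Sec.restrict {K K' : Set E} (σ : Sec O F K) (h : K' ⊆ K) : Sec O F K' where
  v a ha := σ.v a (ha.mono (Set.inter_subset_inter_right _ h))
  compat a b _ _ hab := σ.compat a b _ _ hab

def IsBas (O : X → Set E) : Prop := ∀ y, ∀ N ∈ 𝓝 y, ∃ a, y ∈ O a ∧ O a ⊆ N

theorem sec_unique (hopen : ∀ a, IsOpen (O a)) (hbas : IsBas O) {K : Set E} (hK : IsPreconnected K)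
    (σ τ : Sec O F K) (a b : X) (ha : (O a ∩ K).Nonempty) (hb : (O b ∩ K).Nonempty)
    (hab : σ.v a ha = τ.v a ha) : σ.v b hb = τ.v b hb := by
  have key : ∀ y ∈ K, ∀ a b ha hb, y ∈ O a → y ∈ O b → σ.v a ha = τ.v a ha → σ.v b hb = τ.v b hb := by
    intro y hy a b ha hb hya hyb h
    obtain ⟨c, hyc, hc⟩ := hbas y (O a ∩ O b) (((hopen a).inter (hopen b)).mem_nhds ⟨hya, hyb⟩)
    have hcK : (O c ∩ K).Nonempty := ⟨y, hyc, hy⟩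
    have h1 : σ.v c hcK = τ.v c hcK := by
      rw [← σ.compat' a c ha hcK (fun z hz => (hc hz).1), ← τ.compat' a c ha hcK (fun z hz => (hc hz).1), h]
    rw [← σ.compat c b hcK hb (fun z hz => (hc hz).2), ← τ.compat c b hcK hb (fun z hz => (hc hz).2), h1]
  obtain ⟨y, hya, hy⟩ := ha
  obtain ⟨z, hzb, hz⟩ := hb
  let Agr : E → Prop := fun y => ∀ a h, y ∈ O a → σ.v a h = τ.v a h
  have := hK.induction₂ (fun y z => Agr y ↔ Agr z) ?_ (fun _ _ _ _ _ _ h h' => h.trans h')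
    (fun _ _ _ _ h => h.symm) hy hz
  · exact this.1 (fun c hc hyc => key y hy _ _ _ _ hya hyc hab) b _ hzb
  · intro x hx
    obtain ⟨c, hxc, -⟩ := hbas x Set.univ Filter.univ_mem
    filter_upwards [mem_nhdsWithin_of_mem_nhds ((hopen c).mem_nhds hxc), self_mem_nhdsWithin] with x' hx' hxK
    constructor
    · intro h b hb hxb
      exact key x' hxK c b ⟨x, hxc, hx⟩ hb hx' hxb (h c _ hxc)
    · intro h b hb hxb
      exact key x hx c b ⟨x, hxc, hx⟩ hb hxc hxb (h c _ hx')

theorem good_small (hopen : ∀ a, IsOpen (O a)) (hbas : IsBas O)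
    (hconn : ∀ a b, IsPreconnected (O a ∩ O b)) (o : X) {K : Set E} (hK : K ⊆ O o) :
    Good O F K := by
  -- independence
  have indep : ∀ (x : F.S o) (b c d : X) (hc : O c ⊆ O o ∩ O b) (hd : O d ⊆ O o ∩ O b),
      (O c).Nonempty → (O d).Nonempty →
      F.tr c b (Or.inl fun z hz => (hc hz).2) (F.tr o c (Or.inr fun z hz => (hc hz).1) x) =
      F.tr d b (Or.inl fun z hz => (hd hz).2) (F.tr o d (Or.inr fun z hz => (hd hz).1) x) := by
    intro x b c d hc hd ⟨y, hy⟩ ⟨z, hz⟩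
    let V : ∀ c, O c ⊆ O o ∩ O b → F.S b := fun c hc =>
      F.tr c b (Or.inl fun z hz => (hc hz).2) (F.tr o c (Or.inr fun z hz => (hc hz).1) x)
    have sub : ∀ c d (hc : O c ⊆ O o ∩ O b) (hd : O d ⊆ O o ∩ O b), O c ⊆ O d → V c hc = V d hd := by
      intro c d hc hd hcd
      simp only [V]
      rw [← F.tri o d c (Or.inr fun z hz => (hd hz).1) (Or.inr hcd) (Or.inr fun z hz => (hc hz).1),
        F.tri d c b (Or.inr hcd) (Or.inl fun z hz => (hc hz).2) (Or.inl fun z hz => (hd hz).2)]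
    have key : ∀ y c d (hc : O c ⊆ O o ∩ O b) (hd : O d ⊆ O o ∩ O b), y ∈ O c → y ∈ O d →
        V c hc = V d hd := by
      intro y c d hc hd hyc hyd
      obtain ⟨e, hye, he⟩ := hbas y (O c ∩ O d) (((hopen c).inter (hopen d)).mem_nhds ⟨hyc, hyd⟩)
      have h1 : O e ⊆ O c := fun z hz => (he hz).1
      have h2 : O e ⊆ O d := fun z hz => (he hz).2
      rw [← sub e c (h1.trans hc) hc h1, ← sub e d (h1.trans hc) hd h2]
    let Val : E → F.S b → Prop := fun y v => ∀ c hc, y ∈ O c → V c hc = v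
    have := (hconn o b).induction₂ (fun y z => ∀ v, Val y v ↔ Val z v) ?_
      (fun _ _ _ _ _ _ h h' v => (h v).trans (h' v))
      (fun _ _ _ _ h v => (h v).symm) (hc hy) (hd hz)
    · exact ((this (V d hd)).2 (fun e he hze => key z e d he hd hze hz)) c hc hy
    · intro y hy
      obtain ⟨e, hye, he⟩ := hbas y (O o ∩ O b) (((hopen o).inter (hopen b)).mem_nhds hy)
      filter_upwards [mem_nhdsWithin_of_mem_nhds ((hopen e).mem_nhds hye)] with y' hy' v
      constructor
      · intro h c hc hyc
        rw [key y' c e hc he hyc hy']; exact h e he hye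
      · intro h c hc hyc
        rw [key y c e hc he hyc hye]; exact h e he hy'
  have ch : ∀ b, (O b ∩ K).Nonempty → ∃ c, O c ⊆ O o ∩ O b ∧ (O c).Nonempty := by
    rintro b ⟨y, hyb, hy⟩
    obtain ⟨e, hye, he⟩ := hbas y (O o ∩ O b) (((hopen o).inter (hopen b)).mem_nhds ⟨hK hy, hyb⟩)
    exact ⟨e, he, y, hye⟩
  choose c hc hcn using ch
  intro a ha x
  let x0 : F.S o := F.tr (c a ha) o (Or.inl fun z hz => (hc a ha hz).1)
    (F.tr a (c a ha) (Or.inr fun z hz => (hc a ha hz).2) x)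
  refine ⟨⟨fun b hb => F.tr (c b hb) b (Or.inl fun z hz => (hc b hb hz).2)
    (F.tr o (c b hb) (Or.inr fun z hz => (hc b hb hz).1) x0), ?_⟩, ?_⟩
  · intro b d hb hd hbd
    rw [← indep x0 d (c b hb) (c d hd) (fun z hz => ⟨(hc b hb hz).1, hbd (hc b hb hz).2⟩) (hc d hd)
      (hcn b hb) (hcn d hd)]
    exact F.tri _ _ _ _ _ _ _
  · simp only [x0]
    rw [F.back, F.back]

theorem good_glue (hopen : ∀ a, IsOpen (O a)) (hbas : IsBas O) {K₁ K₂ : Set E}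
    (hc : IsPreconnected (K₁ ∩ K₂)) (hne : (K₁ ∩ K₂).Nonempty)
    (hm : ∀ a, (O a ∩ K₁).Nonempty → (O a ∩ K₂).Nonempty → (O a ∩ (K₁ ∩ K₂)).Nonempty)
    (h1 : Good O F K₁) (h2 : Good O F K₂) : Good O F (K₁ ∪ K₂) := by
  classical
  -- glue two sections which agree somewhere on the intersection
  have glue : ∀ (σ : Sec O F K₁) (τ : Sec O F K₂),
      (∃ a h h', (O a ∩ (K₁ ∩ K₂)).Nonempty ∧ σ.v a h = τ.v a h') →
      ∃ ρ : Sec O F (K₁ ∪ K₂), (∀ a h h', ρ.v a h = σ.v a h') ∧ (∀ a h h', ρ.v a h = τ.v a h') := by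
    rintro σ τ ⟨a, h, h', hi, he⟩
    have agree : ∀ b hb hb', σ.v b hb = τ.v b hb' := by
      intro b hb hb'
      exact sec_unique hopen hbas hc (σ.restrict Set.inter_subset_left) (τ.restrict Set.inter_subset_right)
        a b hi (hm b hb hb') he
    have hor : ∀ b, (O b ∩ (K₁ ∪ K₂)).Nonempty → ¬ (O b ∩ K₁).Nonempty → (O b ∩ K₂).Nonempty := by
      rintro b ⟨y, hy, hy' | hy'⟩ hn
      · exact absurd ⟨y, hy, hy'⟩ hn
      · exact ⟨y, hy, hy'⟩
    let v : ∀ b, (O b ∩ (K₁ ∪ K₂)).Nonempty → F.S b := fun b hb =>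
      if hb1 : (O b ∩ K₁).Nonempty then σ.v b hb1 else τ.v b (hor b hb hb1)
    have v1 : ∀ b hb hb', v b hb = σ.v b hb' := by
      intro b hb hb'; simp only [v]; rw [dif_pos hb']
    have v2 : ∀ b hb hb', v b hb = τ.v b hb' := by
      intro b hb hb'; simp only [v]
      split_ifs with h
      · exact agree _ _ _
      · rfl
    refine ⟨⟨v, ?_⟩, v1, v2⟩
    intro b d hb hd hbd
    by_cases hb1 : (O b ∩ K₁).Nonempty
    · have hd1 : (O d ∩ K₁).Nonempty := hb1.mono (Set.inter_subset_inter_left _ hbd)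
      rw [v1 b hb hb1, v1 d hd hd1]; exact σ.compat _ _ _ _ hbd
    · have hb2 := hor b hb hb1
      have hd1 : (O d ∩ K₂).Nonempty := hb2.mono (Set.inter_subset_inter_left _ hbd)
      rw [v2 b hb hb2, v2 d hd hd1]; exact τ.compat _ _ _ _ hbd
  obtain ⟨y, hy1, hy2⟩ := hne
  obtain ⟨e, hye, -⟩ := hbas y Set.univ Filter.univ_mem
  have e1 : (O e ∩ K₁).Nonempty := ⟨y, hye, hy1⟩
  have e2 : (O e ∩ K₂).Nonempty := ⟨y, hye, hy2⟩
  intro a ha x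
  by_cases ha1 : (O a ∩ K₁).Nonempty
  · obtain ⟨σ, hσ⟩ := h1 a ha1 x
    obtain ⟨τ, hτ⟩ := h2 e e2 (σ.v e e1)
    obtain ⟨ρ, hρ, -⟩ := glue σ τ ⟨e, e1, e2, ⟨y, hye, hy1, hy2⟩, hτ.symm⟩
    exact ⟨ρ, by rw [hρ a ha ha1, hσ]⟩
  · have ha2 : (O a ∩ K₂).Nonempty := by
      obtain ⟨z, hz, hz' | hz'⟩ := ha
      · exact absurd ⟨z, hz, hz'⟩ ha1
      · exact ⟨z, hz, hz'⟩
    obtain ⟨τ, hτ⟩ := h2 a ha2 x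
    obtain ⟨σ, hσ⟩ := h1 e e1 (τ.v e e2)
    obtain ⟨ρ, -, hρ⟩ := glue σ τ ⟨e, e1, e2, ⟨y, hye, hy1, hy2⟩, hσ⟩
    exact ⟨ρ, by rw [hρ a ha ha2, hτ]⟩
end ls

section box
open Topology
variable {X : Type*} {d : ℕ} {O : X → Set (Fin d → ℝ)} {F : LocSys (Adj O)}

theorem good_box (hopen : ∀ a, IsOpen (O a)) (hbas : IsBas O) (hconv : ∀ a, Convex ℝ (O a))
    (A B : Fin d → ℝ) (hAB : A ≤ B) : Good O F (Set.Icc A B) := by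
  classical
  obtain ⟨δ, hδ, hleb⟩ := lebesgue_number_lemma_of_metric (isCompact_Icc (a := A) (b := B)) hopen
    (fun y _ => by
      obtain ⟨a, ha, -⟩ := hbas y Set.univ Filter.univ_mem
      exact Set.mem_iUnion.2 ⟨a, ha⟩)
  have main : ∀ s : Finset (Fin d), ∀ a b : Fin d → ℝ, a ≤ b → A ≤ a → b ≤ B →
      (∀ j ∉ s, b j - a j < δ) → Good O F (Set.Icc a b) := by
    intro s
    induction s using Finset.induction_on with
    | empty =>
      intro a b hab hA hB hsm
      obtain ⟨o, ho⟩ := hleb a ⟨hA, hab.trans hB⟩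
      refine good_small hopen hbas (fun p q => ((hconv p).inter (hconv q)).isPreconnected) o
        (Set.Subset.trans ?_ ho)
      intro y hy
      rw [Metric.mem_ball, dist_pi_lt_iff hδ]
      intro j
      rw [Real.dist_eq, abs_lt]
      have := hy.1 j
      have := hy.2 j
      have := hsm j (by simp)
      constructor <;> linarith
    | insert j s hj ih =>
      have : ∀ n : ℕ, ∀ a b : Fin d → ℝ, a ≤ b → A ≤ a → b ≤ B →
          (∀ i ∉ insert j s, b i - a i < δ) → b j - a j ≤ n * (δ / 2) → Good O F (Set.Icc a b) := by
        intro n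
        induction n with
        | zero =>
          intro a b hab hA hB hsm hn
          refine ih a b hab hA hB (fun i hi => ?_)
          by_cases hij : i = j
          · subst hij; push_cast at hn; linarith
          · exact hsm i (by simp [hij, hi])
        | succ n ihn =>
          intro a b hab hA hB hsm hn
          by_cases hlt : b j - a j < δ
          · refine ih a b hab hA hB (fun i hi => ?_)
            by_cases hij : i = j
            · subst hij; exact hlt
            · exact hsm i (by simp [hij, hi])
          · push_cast at hn
            let m := b j - δ / 2
            have hm1 : a j ≤ m := by simp only [m]; linarith
            have hm2 : m ≤ b j := by simp only [m]; linarith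
            let b' := Function.update b j m
            let a' := Function.update a j m
            have e1 : a ≤ b' := by
              intro i
              by_cases hij : i = j
              · subst hij; simpa [b'] using hm1
              · simpa [b', hij] using hab i
            have e2 : a' ≤ b := by
              intro i
              by_cases hij : i = j
              · subst hij; simpa [a'] using hm2
              · simpa [a', hij] using hab i
            have e3 : b' ≤ b := by
              intro i
              by_cases hij : i = j
              · subst hij; simpa [b'] using hm2
              · simp [b', hij]
            have e4 : a ≤ a' := by
              intro i
              by_cases hij : i = j
              · subst hij; simpa [a'] using hm1
              · simp [a', hij]
            have e5 : a' ≤ b' := by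
              intro i
              by_cases hij : i = j
              · subst hij; simp [a', b']
              · simpa [a', b', hij] using hab i
            have hun : Set.Icc a b = Set.Icc a b' ∪ Set.Icc a' b := by
              apply Set.Subset.antisymm
              · intro y hy
                rcases le_total (y j) m with h | h
                · left
                  refine ⟨hy.1, fun i => ?_⟩
                  by_cases hij : i = j
                  · subst hij; simpa [b'] using h
                  · simpa [b', hij] using hy.2 i
                · right
                  refine ⟨fun i => ?_, hy.2⟩
                  by_cases hij : i = j
                  · subst hij; simpa [a'] using h
                  · simpa [a', hij] using hy.1 i
              · exact Set.union_subset (Set.Icc_subset_Icc le_rfl e3) (Set.Icc_subset_Icc e4 le_rfl)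
            have g1 : Good O F (Set.Icc a b') := by
              refine ihn a b' e1 hA (e3.trans hB) (fun i hi => ?_) ?_
              · have : i ≠ j := by rintro rfl; simp at hi
                simpa [b', this] using hsm i hi
              · simp only [b', Function.update_self, m]; linarith
            have g2 : Good O F (Set.Icc a' b) := by
              refine ih a' b e2 (hA.trans e4) hB (fun i hi => ?_)
              by_cases hij : i = j
              · subst hij; simp only [a', Function.update_self, m]; linarith
              · simpa [a', hij] using hsm i (by simp [hij, hi])
            rw [hun]
            refine good_glue hopen hbas ?_ ⟨a', ⟨e4, e5⟩, ⟨le_rfl, e2⟩⟩ ?_ g1 g2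
            · exact ((convex_Icc a b').inter (convex_Icc a' b)).isPreconnected
            · intro o h1 h2
              have hp : IsPreconnected (O o ∩ Set.Icc a b) := ((hconv o).inter (convex_Icc a b)).isPreconnected
              rw [isPreconnected_closed_iff] at hp
              have := hp (Set.Icc a b') (Set.Icc a' b) isClosed_Icc isClosed_Icc
                (by rw [← hun]; exact Set.inter_subset_right)
                (by
                  obtain ⟨y, hy, hy'⟩ := h1
                  exact ⟨y, ⟨hy, by rw [hun]; exact Or.inl hy'⟩, hy'⟩)
                (by
                  obtain ⟨y, hy, hy'⟩ := h2
                  exact ⟨y, ⟨hy, by rw [hun]; exact Or.inr hy'⟩, hy'⟩)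
              exact this.mono (Set.inter_subset_inter_left _ Set.inter_subset_left)
      intro a b hab hA hB hsm
      obtain ⟨n, hn⟩ := exists_nat_ge ((b j - a j) / (δ / 2))
      exact this n a b hab hA hB hsm (by rwa [div_le_iff₀ (by positivity)] at hn)
  exact main Finset.univ A B hAB le_rfl le_rfl (by simp)

theorem simply_conn (hopen : ∀ a, IsOpen (O a)) (hbas : IsBas O) (hconv : ∀ a, Convex ℝ (O a))
    (hne : ∀ a, (O a).Nonempty)
    (f g : ℕ → X) (hf : PathW (Adj O) f) (hg : PathW (Adj O) g) (h0 : f 0 = g 0) (K : ℕ) (o : X)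
    (hfK : ∀ k ≥ K, f k = o) (hgK : ∀ k ≥ K, g k = o) : Hom (Adj O) f g := by
  classical
  have hr := adj_refl O
  have hs := adj_symm O
  let F : LocSys (Adj O) := ⟨Cls hs (f 0), tr hr hs, tr_back hr hs, tr_tri hr hs⟩
  choose pt hpt using hne
  -- a box meeting everything
  let T : Finset (Fin d → ℝ) := (Finset.range (K+1)).image (fun k => pt (f k)) ∪
    (Finset.range (K+1)).image (fun k => pt (g k))
  obtain ⟨B, hB⟩ := T.bddAbove
  obtain ⟨A, hA⟩ := T.bddBelow
  have hfT : ∀ k ≤ K, pt (f k) ∈ T := fun k hk =>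
    Finset.mem_union_left _ (Finset.mem_image_of_mem _ (Finset.mem_range.2 (by omega)))
  have hgT : ∀ k ≤ K, pt (g k) ∈ T := fun k hk =>
    Finset.mem_union_right _ (Finset.mem_image_of_mem (fun k => pt (g k)) (Finset.mem_range.2 (by omega)))
  have hfm : ∀ k ≤ K, (O (f k) ∩ Set.Icc A B).Nonempty := fun k hk =>
    ⟨pt (f k), hpt _, hA (hfT k hk), hB (hfT k hk)⟩
  have hgm : ∀ k ≤ K, (O (g k) ∩ Set.Icc A B).Nonempty := fun k hk =>
    ⟨pt (g k), hpt _, hA (hgT k hk), hB (hgT k hk)⟩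
  have hAB : A ≤ B := (hA (hfT 0 (by omega))).trans (hB (hfT 0 (by omega)))
  obtain ⟨σ, hσ⟩ := good_box (F := F) hopen hbas hconv A B hAB (f 0) (hfm 0 (by omega))
    (Quotient.mk (WdSet hs (f 0) (f 0)) (preW hr hf 0))
  have trσ : ∀ a b ha hb (h : Adj O a b), tr hr hs a b h (σ.v a ha) = σ.v b hb := by
    intro a b ha hb h
    rcases h with h | h
    · exact σ.compat a b ha hb h
    · exact σ.compat' a b ha hb h
  have claim : ∀ (f' : ℕ → X) (hf' : PathW (Adj O) f') (h0' : f 0 = f' 0)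
      (hm : ∀ k ≤ K, (O (f' k) ∩ Set.Icc A B).Nonempty) (k : ℕ) (hk : k ≤ K),
      ∃ w : Wd (Adj O) (f 0) (f' k), w.f = pre f' k ∧
      Quotient.mk (WdSet hs (f 0) (f' k)) w = σ.v (f' k) (hm k hk) := by
    intro f' hf' h0' hm k hk
    have hσ' : ∀ h, σ.v (f 0) h = Quotient.mk (WdSet hs (f 0) (f 0)) (preW hr hf 0) := fun h => hσ
    clear hσ
    induction k with
    | zero =>
      refine ⟨⟨pre f' 0, 0, (preW hr hf' 0).path, ?_, (preW hr hf' 0).hK⟩, rfl, ?_⟩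
      · simp [pre, h0']
      · have := trσ (f 0) (f' 0) (hfm 0 (by omega)) (hm 0 hk) (by rw [h0']; exact hr _)
        rw [← this, hσ']
        refine Quotient.sound ?_
        change Hom (Adj O) (pre f' 0) (trunc (pre f 0) 0 (f' 0))
        have e : trunc (pre f 0) 0 (f' 0) = pre f' 0 := by
          funext t; simp [trunc, pre, h0']
        rw [e]; exact Hom.refl _
    | succ k ih =>
      obtain ⟨w, hw, hw'⟩ := ih (by omega)
      have hwp : PathW (Adj O) (pre f' (k+1)) := (preW hr hf' (k+1)).path
      refine ⟨⟨pre f' (k+1), k+1, hwp, ?_, (preW hr hf' (k+1)).hK⟩, rfl, ?_⟩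
      · simp [pre, h0']
      · rw [← trσ (f' k) (f' (k+1)) (hm k (by omega)) (hm (k+1) hk) (hf' k), ← hw']
        refine Quotient.sound ?_
        change Hom (Adj O) (pre f' (k+1)) (trunc w.f w.K (f' (k+1)))
        have e : trunc (pre f' k) k (f' (k+1)) = pre f' (k+1) := by
          funext t
          unfold trunc pre
          split_ifs with h
          · rw [min_eq_left h, min_eq_left (by omega)]
          · rw [min_eq_right (by omega)]
        have hh := ext_congr hr hs (⟨pre f' k, k, (preW hr hf' k).path, by simp [pre, h0'],
          (preW hr hf' k).hK⟩ : Wd (Adj O) (f 0) (f' k)) w (hf' k) (by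
            change Hom _ (pre f' k) w.f
            rw [hw]; exact Hom.refl _)
        change Hom _ (trunc (pre f' k) k (f' (k+1))) (trunc w.f w.K (f' (k+1))) at hh
        rwa [e] at hh
  have preK : ∀ f' : ℕ → X, (∀ k ≥ K, f' k = o) → pre f' K = f' := by
    intro f' h
    funext t
    unfold pre
    by_cases ht : t ≤ K
    · rw [min_eq_left ht]
    · rw [min_eq_right (by omega), h K le_rfl, h t (by omega)]
  obtain ⟨w1, e1, q1⟩ := claim f hf rfl hfm K le_rfl
  obtain ⟨w2, e2, q2⟩ := claim g hg h0 hgm K le_rfl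
  rw [preK f hfK] at e1
  rw [preK g hgK] at e2
  have hfg : f K = g K := by rw [hfK K le_rfl, hgK K le_rfl]
  have : ∀ (x y : X) (h : x = y) (w1 : Wd (Adj O) (f 0) x) (w2 : Wd (Adj O) (f 0) y) hx hy,
      Quotient.mk (WdSet hs (f 0) x) w1 = σ.v x hx → Quotient.mk (WdSet hs (f 0) y) w2 = σ.v y hy →
      Hom (Adj O) w1.f w2.f := by
    rintro x y rfl w1 w2 hx hy h1 h2
    exact Quotient.exact (h1.trans h2.symm)
  have := this _ _ hfg w1 w2 _ _ q1 q2
  rwa [e1, e2] at this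
end box
section basis
open Topology

theorem exists_basis {d n : ℕ} (U : Fin n → Set (Fin d → ℝ)) (hU : ∀ i, IsClosed (U i)) :
    ∃ B : Set (Set (Fin d → ℝ)), B.Countable ∧ (∀ o ∈ B, IsOpen o ∧ Convex ℝ o ∧ o.Nonempty ∧
      ∃ y, {i | (U i ∩ o).Nonempty} = {i | y ∈ U i}) ∧
      ∀ y, ∀ N ∈ 𝓝 y, ∃ o ∈ B, y ∈ o ∧ o ⊆ N ∧ {i | (U i ∩ o).Nonempty} = {i | y ∈ U i} := by
  have hr : ∀ x : Fin d → ℝ, ∃ r > 0, ∀ y ∈ Metric.ball x r, ∀ i, y ∈ U i → x ∈ U i := by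
    intro x
    have : ∀ᶠ y in 𝓝 x, ∀ i, y ∈ U i → x ∈ U i := by
      rw [Filter.eventually_all]
      intro i
      by_cases hx : x ∈ U i
      · exact Filter.Eventually.of_forall fun _ _ => hx
      · filter_upwards [(hU i).isOpen_compl.mem_nhds hx] with y hy hy'
        exact absurd hy' hy
    obtain ⟨r, hr, h⟩ := Metric.eventually_nhds_iff_ball.1 this
    exact ⟨r, hr, h⟩
  choose r hr0 hr using hr
  let b : (Fin d → ℝ) → ℕ → Set (Fin d → ℝ) := fun x m => Metric.ball x (min (r x) (1 / ((m:ℝ)+1)))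
  have bpos : ∀ x (m : ℕ), 0 < min (r x) (1 / ((m:ℝ)+1)) := fun x m => lt_min (hr0 x) Nat.one_div_pos_of_nat
  have blab : ∀ x m, {i | (U i ∩ b x m).Nonempty} = {i | x ∈ U i} := by
    intro x m
    ext i
    constructor
    · rintro ⟨y, hy, hy'⟩
      exact hr x y (Metric.ball_subset_ball (min_le_left _ _) hy') i hy
    · intro hx
      exact ⟨x, hx, Metric.mem_ball_self (bpos x m)⟩
  have hc : ∀ (σ : Set (Fin n)) (m : ℕ), ∃ t ⊆ {x | {i | x ∈ U i} = σ}, t.Countable ∧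
      {x | {i | x ∈ U i} = σ} ⊆ ⋃ x ∈ t, b x m := by
    intro σ m
    exact TopologicalSpace.countable_cover_nhdsWithin
      (fun x _ => mem_nhdsWithin_of_mem_nhds (Metric.ball_mem_nhds x (bpos x m)))
  choose t ht htc hcov using hc
  refine ⟨⋃ σ, ⋃ m, (fun x => b x m) '' t σ m, ?_, ?_, ?_⟩
  · exact Set.countable_iUnion fun σ => Set.countable_iUnion fun m => (htc σ m).image _
  · intro o ho
    simp only [Set.mem_iUnion, Set.mem_image] at ho
    obtain ⟨σ, m, x, hx, rfl⟩ := ho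
    exact ⟨Metric.isOpen_ball, convex_ball _ _, ⟨x, Metric.mem_ball_self (bpos x m)⟩, x, blab x m⟩
  · intro y N hN
    obtain ⟨ε, hε, hεN⟩ := Metric.mem_nhds_iff.1 hN
    obtain ⟨m, hm⟩ := exists_nat_one_div_lt (half_pos hε)
    have := hcov {i | y ∈ U i} m rfl
    simp only [Set.mem_iUnion] at this
    obtain ⟨x, hx, hyx⟩ := this
    refine ⟨b x m, ?_, hyx, ?_, ?_⟩
    · simp only [Set.mem_iUnion]
      exact ⟨_, m, Set.mem_image_of_mem _ hx⟩
    · intro z hz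
      apply hεN
      have h1 : dist y x < 1 / ((m:ℝ)+1) := lt_of_lt_of_le hyx (min_le_right _ _)
      have h2 : dist z x < 1 / ((m:ℝ)+1) := lt_of_lt_of_le hz (min_le_right _ _)
      rw [Metric.mem_ball]
      have := dist_triangle_right z y x
      linarith
    · rw [blab]; exact ht _ _ hx

theorem G_conn {X E : Type*} [TopologicalSpace E] {O : X → Set E} (hopen : ∀ a, IsOpen (O a))
    (hbas : IsBas O) {U : Set E} (hU : IsPreconnected U) (a b : X) (ha : (U ∩ O a).Nonempty)
    (hb : (U ∩ O b).Nonempty) :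
    Relation.ReflTransGen (fun x y => (U ∩ O x).Nonempty ∧ (U ∩ O y).Nonempty ∧ Adj O x y) a b := by
  set R := (fun x y => (U ∩ O x).Nonempty ∧ (U ∩ O y).Nonempty ∧ Adj O x y) with hR
  have key : ∀ y ∈ U, ∀ a b, y ∈ O a → y ∈ O b → Relation.ReflTransGen R a b := by
    intro y hy a b hya hyb
    obtain ⟨c, hyc, hc⟩ := hbas y (O a ∩ O b) (((hopen a).inter (hopen b)).mem_nhds ⟨hya, hyb⟩)
    refine Relation.ReflTransGen.head (b := c) ⟨⟨y, hy, hya⟩, ⟨y, hy, hyc⟩, Or.inr fun z hz => (hc hz).1⟩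
      (Relation.ReflTransGen.single ⟨⟨y, hy, hyc⟩, ⟨y, hy, hyb⟩, Or.inl fun z hz => (hc hz).2⟩)
  obtain ⟨y, hy, hya⟩ := ha
  obtain ⟨z, hz, hzb⟩ := hb
  have := hU.induction₂' (fun y z => ∀ a b, y ∈ O a → z ∈ O b → Relation.ReflTransGen R a b) ?_ ?_ hy hz
  · exact this a b hya hzb
  · intro x hx
    obtain ⟨c, hxc, -⟩ := hbas x Set.univ Filter.univ_mem
    filter_upwards [mem_nhdsWithin_of_mem_nhds ((hopen c).mem_nhds hxc), self_mem_nhdsWithin] with x' hx' hxU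
    exact ⟨fun a b ha hb => (key x hx a c ha hxc).trans (key x' hxU c b hx' hb),
      fun a b ha hb => (key x' hxU a c ha hx').trans (key x hx c b hxc hb)⟩
  · intro x y z hx hy hz h1 h2 a b ha hb
    obtain ⟨c, hc, -⟩ := hbas y Set.univ Filter.univ_mem
    exact (h1 a c ha hc).trans (h2 c b hc hb)
end basis

section rich
variable {X : Type*} {A : X → X → Prop}

theorem inf_often (T : Type*) [Countable T] [Nonempty T] :
    ∃ e : ℕ → T, ∀ t K, ∃ n ≥ K, e n = t := by
  obtain ⟨g, hg⟩ := exists_surjective_nat T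
  refine ⟨fun n => g (Nat.unpair n).1, fun t K => ?_⟩
  obtain ⟨a, ha⟩ := hg t
  exact ⟨Nat.pair a K, Nat.right_le_pair a K, by simp [ha]⟩

/-- candidate extension -/
def cand (x0 : X) (N : ℕ) (β : List X) (p : (ℕ → X) × ℕ) : (ℕ → X) × ℕ :=
  (fun k => if k < p.2 then p.1 k else if k < 2 * p.2 - N then p.1 (2 * p.2 - 1 - k) else
    β.getD (k - (2 * p.2 - N)) x0, 2 * p.2 - N + β.length)

def PathTo (A : X → X → Prop) (p : (ℕ → X) × ℕ) : Prop := ∀ k, k + 1 < p.2 → A (p.1 k) (p.1 (k+1))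

open Classical in
noncomputable def nxt (A : X → X → Prop) (x0 : X) (t : ℕ × List X) (p : (ℕ → X) × ℕ) : (ℕ → X) × ℕ :=
  if t.1 < p.2 ∧ PathTo A (cand x0 t.1 t.2 p) then cand x0 t.1 t.2 p else cand x0 0 [] p

noncomputable def stt (A : X → X → Prop) (x0 : X) (e : ℕ → ℕ × List X) : ℕ → (ℕ → X) × ℕ
  | 0 => (fun _ => x0, 1)
  | n+1 => nxt A x0 (e n) (stt A x0 e n)

theorem cand_path (hr : ∀ x, A x x) (hs : ∀ x y, A x y → A y x) (x0 : X) (N : ℕ) (β : List X) (p : (ℕ → X) × ℕ) (hp : PathTo A p)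
    (hN : N < p.2) (hβ : ∀ k, k < β.length →
      A ((p.1 N :: β).getD k x0) ((p.1 N :: β).getD (k+1) x0)) :
    PathTo A (cand x0 N β p) := by
  intro k hk
  simp only [cand] at hk ⊢
  by_cases h1 : k + 1 < p.2
  · rw [if_pos (by omega), if_pos h1]; exact hp k h1
  · by_cases h2 : k + 1 = p.2
    · rw [if_pos (by omega), if_neg h1, if_pos (by omega)]
      rw [show 2 * p.2 - 1 - (k+1) = k by omega]; exact hr _
    · rw [if_neg (show ¬ k < p.2 by omega), if_neg (show ¬ k + 1 < p.2 by omega)]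
      by_cases h3 : k + 1 < 2 * p.2 - N
      · rw [if_pos (show k < 2 * p.2 - N by omega), if_pos h3]
        have := hp (2 * p.2 - 1 - (k+1)) (by omega)
        rw [show 2 * p.2 - 1 - (k+1) + 1 = 2 * p.2 - 1 - k by omega] at this
        exact hs _ _ this
      · rw [if_neg h3]
        by_cases h4 : k + 1 = 2 * p.2 - N
        · rw [if_pos (show k < 2 * p.2 - N by omega), h4, Nat.sub_self]
          have := hβ 0 (by omega)
          rw [show 2 * p.2 - 1 - k = N by omega]
          simpa using this
        · rw [if_neg (show ¬ k < 2 * p.2 - N by omega)]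
          have := hβ (k - (2 * p.2 - N) + 1) (by omega)
          rw [List.getD_cons_succ, List.getD_cons_succ] at this
          rwa [show k - (2 * p.2 - N) + 1 = k + 1 - (2 * p.2 - N) by omega] at this

theorem exists_rich [Countable X] (hr : ∀ x, A x x) (hs : ∀ x y, A x y → A y x) (x0 : X) :
    ∃ c : ℕ → X, c 0 = x0 ∧ PathW A c ∧ ∀ (N : ℕ) (β : ℕ → X) (l : ℕ), β 0 = c N →
      (∀ k < l, A (β k) (β (k+1))) → ∀ K, ∃ m ≥ K, N < m ∧ (∀ k, N + k < m → c (m+k) = c (m-1-k)) ∧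
        ∀ k ≤ l, c (2*m-1-N+k) = β k := by
  classical
  obtain ⟨e, he⟩ := inf_often (ℕ × List X)
  let p := stt A x0 e
  have hpos : ∀ n, n < (p n).2 := by
    intro n
    induction n with
    | zero => simp [p, stt]
    | succ n ih =>
      change n + 1 < (nxt A x0 (e n) (p n)).2
      unfold nxt
      split_ifs with h
      · have := h.1
        simp only [cand]; omega
      · simp only [cand]; omega
  have hpath : ∀ n, PathTo A (p n) := by
    intro n
    induction n with
    | zero => intro k hk; simp [p, stt] at hk
    | succ n ih =>
      change PathTo A (nxt A x0 (e n) (p n))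
      unfold nxt
      split_ifs with h
      · exact h.2
      · exact cand_path hr hs x0 0 [] _ ih (by have := hpos n; omega) (by simp)
  have hlen : ∀ n, (p n).2 < (p (n+1)).2 := by
    intro n
    change (p n).2 < (nxt A x0 (e n) (p n)).2
    have := hpos n
    unfold nxt
    split_ifs with h
    · have := h.1
      simp only [cand]; omega
    · simp only [cand]; omega
  have hstab1 : ∀ n k, k < (p n).2 → (p (n+1)).1 k = (p n).1 k := by
    intro n k hk
    change (nxt A x0 (e n) (p n)).1 k = _
    unfold nxt
    split_ifs with h
    · simp only [cand]; rw [if_pos hk]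
    · simp only [cand]; rw [if_pos hk]
  have hmono : Monotone fun n => (p n).2 := monotone_nat_of_le_succ fun n => (hlen n).le
  have hstab : ∀ n n', n ≤ n' → ∀ k, k < (p n).2 → (p n').1 k = (p n).1 k := by
    intro n n' hn k hk
    induction n', hn using Nat.le_induction with
    | base => rfl
    | succ n' hn ih => rw [hstab1 n' k (lt_of_lt_of_le hk (hmono hn)), ih]
  let c : ℕ → X := fun k => (p k).1 k
  have hc : ∀ n k, k < (p n).2 → c k = (p n).1 k := by
    intro n k hk
    rcases le_total n k with h | h
    · exact hstab n k h k hk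
    · exact (hstab k n h k (hpos k)).symm
  refine ⟨c, rfl, ?_, ?_⟩
  · intro k
    have h1 := hpos (k+1)
    rw [hc (k+1) k (by omega), hc (k+1) (k+1) h1]
    exact hpath (k+1) k h1
  · intro N β l hβ0 hβ K
    let L := (List.range l).map (fun k => β (k+1))
    have hL : L.length = l := by simp [L]
    have hLg : ∀ k ≤ l, (c N :: L).getD k x0 = β k := by
      intro k hk
      rcases k with _ | k
      · simp [hβ0]
      · rw [List.getD_cons_succ, List.getD_eq_getElem _ _ (by omega)]
        simp [L]
    obtain ⟨n, hn, hen⟩ := he (N, L) (max K N)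
    have hnK : K ≤ n := le_trans (le_max_left _ _) hn
    have hnN : N ≤ n := le_trans (le_max_right _ _) hn
    have hm := hpos n
    have hNm : N < (p n).2 := by omega
    have hcN : c N = (p n).1 N := hc n N hNm
    have hv : PathTo A (cand x0 N L (p n)) := by
      refine cand_path hr hs x0 N L (p n) (hpath n) hNm ?_
      intro k hk
      rw [← hcN, hLg k (by omega), hLg (k+1) (by omega)]
      exact hβ k (by omega)
    have hp1 : p (n+1) = cand x0 N L (p n) := by
      change nxt A x0 (e n) (p n) = _
      rw [hen]; unfold nxt
      rw [if_pos ⟨hNm, hv⟩]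
    have hp2 : (p (n+1)).2 = 2 * (p n).2 - N + l := by rw [hp1]; simp only [cand, hL]
    have hp3 : ∀ k, (p n).2 ≤ k → k < 2 * (p n).2 - N → (p (n+1)).1 k = (p n).1 (2 * (p n).2 - 1 - k) := by
      intro k h1 h2
      rw [hp1]; simp only [cand]
      rw [if_neg (by omega), if_pos h2]
    have hmir : ∀ k, N + k < (p n).2 → c ((p n).2+k) = c ((p n).2-1-k) := by
      intro k hk
      rw [hc (n+1) _ (by omega), hc n ((p n).2 - 1 - k) (by omega), hp3 _ (by omega) (by omega),
        show 2 * (p n).2 - 1 - ((p n).2 + k) = (p n).2 - 1 - k by omega]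
    refine ⟨(p n).2, by omega, hNm, hmir, ?_⟩
    intro k hk
    rcases k with _ | k
    · have := hmir ((p n).2 - 1 - N) (by omega)
      rw [hβ0]
      rw [show 2 * (p n).2 - 1 - N + 0 = (p n).2 + ((p n).2 - 1 - N) by omega, this]
      congr 1; omega
    · rw [hc (n+1) _ (by omega), hp1]
      simp only [cand]
      rw [if_neg (by omega), if_neg (by omega), ← hLg (k+1) hk, List.getD_cons_succ]
      congr 1; omega

theorem mirror {c : ℕ → X} (hs : ∀ x y, A x y → A y x)
    (hrich : ∀ (N : ℕ) (β : ℕ → X) (l : ℕ), β 0 = c N →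
      (∀ k < l, A (β k) (β (k+1))) → ∀ K, ∃ m ≥ K, N < m ∧ (∀ k, N + k < m → c (m+k) = c (m-1-k)) ∧
        ∀ k ≤ l, c (2*m-1-N+k) = β k)
    (w : ℕ → X) (hw : PathW A w) (N : ℕ) (hN : ∀ t ≥ N, w t = c t) (s : ℕ) (hsN : s ≤ N) (K : ℕ) :
    ∃ m ≥ K, N < m ∧ ∀ k, s + k < m → w (m+k) = w (m-1-k) := by
  obtain ⟨m, hm, hNm, h1, h2⟩ := hrich N (fun k => w (N-k)) (N-s) (by simp [hN]) (by
    intro k hk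
    have := hw (N-(k+1))
    rw [show N - (k+1) + 1 = N - k by omega] at this
    exact hs _ _ this) K
  refine ⟨m, hm, hNm, fun k hk => ?_⟩
  rw [hN (m+k) (by omega)]
  by_cases h : N + k < m
  · rw [h1 k h, hN _ (by omega)]
  · have := h2 (k + N + 1 - m) (by omega)
    rw [show 2*m-1-N + (k+N+1-m) = m + k by omega] at this
    rw [this]; congr 1; omega
end rich
section tree
variable {X : Type*}

open Classical in
noncomputable def app (A : X → X → Prop) (p : ℕ × X) (w : ℕ → X) : ℕ → X :=
  if Mv A w p.1 p.2 then Function.update w (p.1+1) p.2 else w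

noncomputable def W (A : X → X → Prop) (c : ℕ → X) (mv : ℕ → ℕ × X) : ℕ → ℤ → ℕ → X
  | 0, _ => c
  | k+1, j => if j % 3 = 1 then app A (mv k) (W A c mv k (j/3)) else W A c mv k (j/3)

variable {A : X → X → Prop} {c : ℕ → X} {mv : ℕ → ℕ × X}

theorem W_zero (j : ℤ) : W A c mv 0 j = c := rfl

theorem W_side0 (k : ℕ) (j : ℤ) : W A c mv (k+1) (3*j) = W A c mv k j := by
  rw [W, if_neg (by omega), show 3 * j / 3 = j by omega]

theorem W_mid (k : ℕ) (j : ℤ) : W A c mv (k+1) (3*j+1) = app A (mv k) (W A c mv k j) := by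
  rw [W, if_pos (by omega), show (3 * j + 1) / 3 = j by omega]

theorem W_cases (k : ℕ) (j : ℤ) : W A c mv (k+1) j = W A c mv k (j/3) ∨
    (j % 3 = 1 ∧ W A c mv (k+1) j = app A (mv k) (W A c mv k (j/3))) := by
  rw [W]
  split_ifs with h
  · exact Or.inr ⟨h, rfl⟩
  · exact Or.inl rfl

theorem app_far (p : ℕ × X) (w : ℕ → X) (t : ℕ) (ht : p.1 + 2 ≤ t) : app A p w t = w t := by
  unfold app
  split_ifs
  · rw [Function.update_of_ne (by omega)]
  · rfl

theorem app_path (hs : ∀ x y, A x y → A y x) (p : ℕ × X) (w : ℕ → X) (hw : PathW A w) :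
    PathW A (app A p w) := by
  unfold app
  split_ifs with h
  · exact path_update hs hw h
  · exact hw

theorem W_path (hs : ∀ x y, A x y → A y x) (hc : PathW A c) (k : ℕ) :
    ∀ j, PathW A (W A c mv k j) := by
  induction k with
  | zero => intro j; exact hc
  | succ k ih =>
    intro j
    rcases W_cases (A := A) (c := c) (mv := mv) k j with h | ⟨-, h⟩
    · rw [h]; exact ih _
    · rw [h]; exact app_path hs _ _ (ih _)

section conn
variable {G : X → Prop} {R : ℕ × ℤ × ℕ → ℕ × ℤ × ℕ → Prop}

theorem stay (hR0 : ∀ x, R x x) (hRt : ∀ x y z, R x y → R y z → R x z)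
    (h2 : ∀ k j t r, 0 ≤ r → r < 3 → G (W A c mv k j t) → G (W A c mv (k+1) (3*j+r) t) →
      R (k, j, t) (k+1, 3*j+r, t))
    (k : ℕ) (j : ℤ) (n : ℕ) (hn : k ≤ n) : ∃ j', W A c mv n j' = W A c mv k j ∧
      ∀ t, G (W A c mv k j t) → R (k, j, t) (n, j', t) := by
  induction n, hn using Nat.le_induction with
  | base => exact ⟨j, rfl, fun t _ => hR0 _⟩
  | succ n hn ih =>
    obtain ⟨j', h, h'⟩ := ih
    refine ⟨3*j', by rw [W_side0, h], fun t ht => hRt _ _ _ (h' t ht) ?_⟩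
    have := h2 n j' t 0 le_rfl (by norm_num) (by rwa [h]) (by rw [add_zero, W_side0, h]; exact ht)
    rwa [add_zero] at this

theorem descent (hR0 : ∀ x, R x x) (hRt : ∀ x y z, R x y → R y z → R x z)
    (h2 : ∀ k j t r, 0 ≤ r → r < 3 → G (W A c mv k j t) → G (W A c mv (k+1) (3*j+r) t) →
      R (k, j, t) (k+1, 3*j+r, t)) (hmv : ∀ p K, ∃ n ≥ K, mv n = p)
    (k : ℕ) (j : ℤ) (a b : ℕ) (w' : ℕ → X) (h : HomIn A a b (W A c mv k j) w') :
    ∃ k' j', W A c mv k' j' = w' ∧ ∀ t, (t ≤ a ∨ b ≤ t) → G (W A c mv k j t) →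
      R (k, j, t) (k', j', t) := by
  induction h with
  | refl => exact ⟨k, j, rfl, fun t _ _ => hR0 _⟩
  | @tail w w' h1 hst ih =>
    obtain ⟨k', j', hW, hc'⟩ := ih
    obtain ⟨s, u, has, hsb, hM, rfl⟩ := hst
    obtain ⟨n, hn, hnm⟩ := hmv (s, u) k'
    obtain ⟨j2, hj2, hR2⟩ := stay hR0 hRt h2 k' j' n hn
    have hm : W A c mv (n+1) (3*j2+1) = Function.update w (s+1) u := by
      rw [W_mid, hj2, hW, hnm, app, if_pos hM]
    refine ⟨n+1, 3*j2+1, hm, fun t ht hG => ?_⟩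
    have e1 : w t = W A c mv k j t := HomIn.eq_out h1 t ht
    have hG1 : G (w t) := by rw [e1]; exact hG
    refine hRt _ _ _ (hRt _ _ _ (hc' t ht hG) (hR2 t (by rwa [hW]))) ?_
    refine h2 n j2 t 1 (by norm_num) (by norm_num) (by rwa [hj2, hW]) ?_
    rw [hm, Function.update_of_ne (by omega)]; exact hG1

theorem ancestor (hR0 : ∀ x, R x x) (hRs : ∀ x y, R x y → R y x) (hRt : ∀ x y z, R x y → R y z → R x z)
    (h2 : ∀ k j t r, 0 ≤ r → r < 3 → G (W A c mv k j t) → G (W A c mv (k+1) (3*j+r) t) →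
      R (k, j, t) (k+1, 3*j+r, t)) (k : ℕ) : ∀ j, ∃ N j0, ∀ t ≥ N, W A c mv k j t = c t ∧
        (G (c t) → R (k, j, t) (0, j0, t)) := by
  induction k with
  | zero => intro j; exact ⟨0, j, fun t _ => ⟨rfl, fun _ => hR0 _⟩⟩
  | succ k ih =>
    intro j
    obtain ⟨N, j0, h⟩ := ih (j/3)
    refine ⟨max N ((mv k).1 + 2), j0, fun t ht => ?_⟩
    have hN : N ≤ t := le_trans (le_max_left _ _) ht
    have hm : (mv k).1 + 2 ≤ t := le_trans (le_max_right _ _) ht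
    obtain ⟨e, hR⟩ := h t hN
    have e2 : W A c mv (k+1) j t = c t := by
      rw [← e]
      rcases W_cases (A := A) (c := c) (mv := mv) k j with h | ⟨-, h⟩
      · rw [h]
      · rw [h, app_far _ _ _ hm]
    refine ⟨e2, fun hG => hRt _ _ _ (hRs _ _ ?_) (hR hG)⟩
    have := h2 k (j/3) t (j%3) (by omega) (by omega) (by rwa [e])
      (by rw [show 3 * (j/3) + j % 3 = j by omega, e2]; exact hG)
    rwa [show 3 * (j/3) + j % 3 = j by omega] at this

theorem run (hR0 : ∀ x, R x x) (hRt : ∀ x y z, R x y → R y z → R x z)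
    (h1 : ∀ k j t, G (W A c mv k j t) → G (W A c mv k j (t+1)) → R (k, j, t) (k, j, t+1))
    (k : ℕ) (j : ℤ) (a b : ℕ) (hab : a ≤ b) (h : ∀ t, a ≤ t → t ≤ b → G (W A c mv k j t)) :
    R (k, j, a) (k, j, b) := by
  induction b, hab using Nat.le_induction with
  | base => exact hR0 _
  | succ b hb ih =>
    exact hRt _ _ _ (ih fun t h1 h2 => h t h1 (by omega)) (h1 _ _ _ (h b hb (by omega)) (h (b+1) (by omega) le_rfl))

theorem seq_of_rtg (hr : ∀ x, A x x) (a b : X)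
    (h : ReflTransGen (fun x y => G x ∧ G y ∧ A x y) a b) (ha : G a) :
    ∃ (q : ℕ → X) (K : ℕ), q 0 = a ∧ (∀ k ≥ K, q k = b) ∧ (∀ k, G (q k)) ∧ PathW A q := by
  induction h with
  | refl => exact ⟨fun _ => a, 0, rfl, fun _ _ => rfl, fun _ => ha, fun _ => hr a⟩
  | @tail x y h1 h2 ih =>
    obtain ⟨q, K, q0, qK, qG, qp⟩ := ih
    refine ⟨trunc q K y, K+1, by simp [trunc, q0], fun k hk => ?_, fun k => ?_, ?_⟩
    · simp only [trunc]; rw [if_neg (by omega)]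
    · simp only [trunc]; split_ifs
      · exact qG k
      · exact h2.2.1
    · exact path_trunc hr qp (by rw [qK K le_rfl]; exact h2.2.2)

theorem to_base (hr : ∀ x, A x x) (hs : ∀ x y, A x y → A y x) (hc : PathW A c)
    (hrich : ∀ (N : ℕ) (β : ℕ → X) (l : ℕ), β 0 = c N →
      (∀ k < l, A (β k) (β (k+1))) → ∀ K, ∃ m ≥ K, N < m ∧ (∀ k, N + k < m → c (m+k) = c (m-1-k)) ∧
        ∀ k ≤ l, c (2*m-1-N+k) = β k)
    (hmv : ∀ p K, ∃ n ≥ K, mv n = p)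
    (hR0 : ∀ x, R x x) (hRs : ∀ x y, R x y → R y x) (hRt : ∀ x y z, R x y → R y z → R x z)
    (h1 : ∀ k j t, G (W A c mv k j t) → G (W A c mv k j (t+1)) → R (k, j, t) (k, j, t+1))
    (h2 : ∀ k j t r, 0 ≤ r → r < 3 → G (W A c mv k j t) → G (W A c mv (k+1) (3*j+r) t) →
      R (k, j, t) (k+1, 3*j+r, t))
    (h3 : ∀ j t, G (c t) → R (0, j, t) (0, j+1, t))
    (k : ℕ) (j : ℤ) (s : ℕ) (hG : G (W A c mv k j s)) :
    ∃ b, G (c b) ∧ R (k, j, s) (0, 0, b) := by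
  have hor : ∀ j t, G (c t) → R (0, j, t) (0, 0, t) := by
    intro j t ht
    induction j using Int.induction_on with
    | zero => exact hR0 _
    | succ i ih => exact hRt _ _ _ (hRs _ _ (h3 _ t ht)) ih
    | pred i ih =>
      have := h3 (-(i:ℤ) - 1) t ht
      rw [sub_add_cancel] at this
      exact hRt _ _ _ this ih
  have hw := W_path (mv := mv) hs hc k j
  obtain ⟨N, j0, hN⟩ := ancestor hR0 hRs hRt h2 k j
  obtain ⟨m, hm, hNm, hmir⟩ := mirror hs hrich (W A c mv k j) hw (max N s)
    (fun t ht => (hN t (le_trans (le_max_left _ _) ht)).1) s (le_max_right _ _) 0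
  have hNm1 : N < m := lt_of_le_of_lt (le_max_left _ _) hNm
  have hsm : s < m := lt_of_le_of_lt (le_max_right _ _) hNm
  have hpal : ∀ i ≤ 2*m-1-2*s, W A c mv k j (s+i) = W A c mv k j (s+(2*m-1-2*s)-i) := by
    intro i hi
    by_cases h : s + i < m
    · have := hmir (m-1-(s+i)) (by omega)
      rw [show m - 1 - (m-1-(s+i)) = s + i by omega] at this
      rw [← this]; congr 1; omega
    · have := hmir (s+i-m) (by omega)
      rw [show m + (s+i-m) = s + i by omega] at this
      rw [this]; congr 1; omega
  obtain ⟨w', hh, hcst⟩ := fold_pal hr hs (2*m-1-2*s) s (W A c mv k j) hw hpal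
  obtain ⟨k', j', hW', hR'⟩ := descent hR0 hRt h2 hmv k j _ _ w' hh
  have hb : s + (2*m-1-2*s) = 2*m-1-s := by omega
  have eb : W A c mv k j (2*m-1-s) = W A c mv k j s := by
    have := hpal 0 (by omega)
    rw [← hb]; exact this.symm
  have hGb : G (W A c mv k j (2*m-1-s)) := by rw [eb]; exact hG
  obtain ⟨e3, hRb⟩ := hN (2*m-1-s) (by omega)
  have hGc : G (c (2*m-1-s)) := by rw [← e3]; exact hGb
  refine ⟨2*m-1-s, hGc, ?_⟩
  refine hRt _ _ _ (hR' s (Or.inl le_rfl) hG) ?_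
  refine hRt _ _ _ (run hR0 hRt h1 k' j' s (2*m-1-s) (by omega) ?_) ?_
  · intro t h1 h2
    rw [hW', hcst t h1 (by omega)]; exact hG
  · refine hRt _ _ _ (hRs _ _ (hR' _ (Or.inr (by omega)) hGb)) ?_
    exact hRt _ _ _ (hRb hGc) (hor _ _ hGc)

theorem base_conn (hr : ∀ x, A x x) (hs : ∀ x y, A x y → A y x) (hc : PathW A c)
    (hrich : ∀ (N : ℕ) (β : ℕ → X) (l : ℕ), β 0 = c N →
      (∀ k < l, A (β k) (β (k+1))) → ∀ K, ∃ m ≥ K, N < m ∧ (∀ k, N + k < m → c (m+k) = c (m-1-k)) ∧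
        ∀ k ≤ l, c (2*m-1-N+k) = β k)
    (hmv : ∀ p K, ∃ n ≥ K, mv n = p)
    (hsc : ∀ f g : ℕ → X, PathW A f → PathW A g → f 0 = g 0 → ∀ (K : ℕ) (o : X),
      (∀ k ≥ K, f k = o) → (∀ k ≥ K, g k = o) → Hom A f g)
    (hGc : ∀ a b, G a → G b → ReflTransGen (fun x y => G x ∧ G y ∧ A x y) a b)
    (hR0 : ∀ x, R x x) (hRs : ∀ x y, R x y → R y x) (hRt : ∀ x y z, R x y → R y z → R x z)
    (h1 : ∀ k j t, G (W A c mv k j t) → G (W A c mv k j (t+1)) → R (k, j, t) (k, j, t+1))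
    (h2 : ∀ k j t r, 0 ≤ r → r < 3 → G (W A c mv k j t) → G (W A c mv (k+1) (3*j+r) t) →
      R (k, j, t) (k+1, 3*j+r, t))
    (b b' : ℕ) (hbb : b ≤ b') (hb : G (c b)) (hb' : G (c b')) : R (0, 0, b) (0, 0, b') := by
  obtain ⟨q, Kq, q0, qK, qG, qp⟩ := seq_of_rtg hr (c b) (c b') (hGc _ _ hb hb') hb
  let p : ℕ → X := trunc (fun k => c (b+k)) (b'-b) (c b')
  have hpp : PathW A p := by
    refine path_trunc hr (fun k => hc (b+k)) ?_
    rw [show b + (b'-b) = b' by omega]; exact hr _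
  have hpK : ∀ k ≥ b'-b, p k = c b' := by
    intro k hk
    simp only [p, trunc]
    split_ifs with h
    · rw [show b + k = b' by omega]
    · rfl
  have hplow : ∀ k ≤ b'-b, p k = c (b+k) := by
    intro k hk
    simp only [p, trunc]; rw [if_pos hk]
  obtain ⟨K0, hK0⟩ := hsc p q hpp qp (by rw [hplow 0 (by omega), q0, add_zero]) (max (b'-b) Kq) (c b')
    (fun k hk => hpK k (le_trans (le_max_left _ _) hk)) (fun k hk => qK k (le_trans (le_max_right _ _) hk))
  obtain ⟨K, hKdef⟩ : ∃ K, K = K0 + (b'-b) + Kq := ⟨_, rfl⟩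
  have hpq : HomIn A 0 K p q := hK0.mono le_rfl (by omega)
  obtain ⟨m, hm, hNm, hmir⟩ := mirror hs hrich c hc b' (fun _ _ => rfl) b' le_rfl (b + K + b' + 1)
  have hpal : ∀ i ≤ 2*m-1-2*b', c (b'+i) = c (b'+(2*m-1-2*b')-i) := by
    intro i hi
    by_cases h : b' + i < m
    · have := hmir (m-1-(b'+i)) (by omega)
      rw [show m - 1 - (m-1-(b'+i)) = b' + i by omega] at this
      rw [← this]; congr 1; omega
    · have := hmir (b'+i-m) (by omega)
      rw [show m + (b'+i-m) = b' + i by omega] at this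
      rw [this]; congr 1; omega
  obtain ⟨w1, hh1, hw1⟩ := fold_pal hr hs (2*m-1-2*b') b' c hc hpal
  have ee : b' + (2*m-1-2*b') = 2*m-1-b' := by omega
  obtain ⟨k1, j1, hW1, hR1⟩ := descent hR0 hRt h2 hmv 0 0 _ _ w1 (show HomIn A b' _ (W A c mv 0 0) w1 from hh1)
  have hw1p : ∀ k ≤ K, w1 (b+k) = p k := by
    intro k hk
    by_cases h : b + k ≤ b'
    · rw [HomIn.eq_out hh1 _ (Or.inl h), hplow k (by omega)]
    · rw [hw1 _ (by omega) (by omega), hpK k (by omega)]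
  obtain ⟨w2, hh2, hw2⟩ := hpq.shift b w1 hw1p
  obtain ⟨k2, j2, hW2, hR2⟩ := descent hR0 hRt h2 hmv k1 j1 b (b+K) w2 (by rw [hW1]; exact hh2)
  have gb : G (W A c mv k1 j1 b) := by
    rw [hW1, HomIn.eq_out hh1 _ (Or.inl hbb)]; exact hb
  have g1 : ∀ t, b' ≤ t → t ≤ b + K → G (W A c mv k1 j1 t) := by
    intro t ht ht'
    rw [hW1, hw1 t ht (by omega)]; exact hb'
  refine hRt _ _ _ (hR1 b (Or.inl hbb) hb) ?_
  refine hRt _ _ _ (hR2 b (Or.inl le_rfl) gb) ?_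
  refine hRt _ _ _ (run hR0 hRt h1 k2 j2 b (b+K) (by omega) ?_) ?_
  · intro t ht ht'
    have := hw2 (t-b) (by omega)
    rw [show b + (t-b) = t by omega] at this
    rw [hW2, this]; exact qG _
  refine hRt _ _ _ (hRs _ _ (hR2 (b+K) (Or.inr le_rfl) (g1 _ (by omega) le_rfl))) ?_
  refine hRt _ _ _ (hRs _ _ (run hR0 hRt h1 k1 j1 b' (b+K) (by omega) g1)) ?_
  exact hRs _ _ (hR1 b' (Or.inl le_rfl) hb')

end conn
end tree
section geom
variable {X : Type*} {A : X → X → Prop} {c : ℕ → X} {mv : ℕ → ℕ × X}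

def Nb (A : X → X → Prop) (w w' : ℕ → X) : Prop :=
  ∀ a b, (a = b ∨ a = b + 1 ∨ b = a + 1) → A (w a) (w' b)

theorem Nb.symm (hs : ∀ x y, A x y → A y x) {w w' : ℕ → X} (h : Nb A w w') : Nb A w' w :=
  fun a b hab => hs _ _ (h b a (by omega))

theorem Nb_self (hr : ∀ x, A x x) (hs : ∀ x y, A x y → A y x) {w : ℕ → X} (hw : PathW A w) :
    Nb A w w := by
  rintro a b (rfl | rfl | rfl)
  · exact hr _
  · exact hs _ _ (hw b)
  · exact hw a

theorem Nb_app (hr : ∀ x, A x x) (hs : ∀ x y, A x y → A y x) {w : ℕ → X} (hw : PathW A w)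
    (p : ℕ × X) : Nb A w (app A p w) := by
  unfold app
  split_ifs with h
  · intro a b hab
    by_cases hb : b = p.1 + 1
    · subst hb
      rw [Function.update_self]
      obtain ⟨h1, h2, h3⟩ := h
      rcases hab with rfl | rfl | h4
      · exact h2
      · exact h3
      · rw [show a = p.1 by omega]; exact h1
    · rw [Function.update_of_ne hb]; exact Nb_self hr hs hw a b hab
  · exact Nb_self hr hs hw

theorem Nb_adj (hr : ∀ x, A x x) (hs : ∀ x y, A x y → A y x) (hc : PathW A c) (k : ℕ) :
    ∀ j, Nb A (W A c mv k j) (W A c mv k (j+1)) := by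
  induction k with
  | zero => intro j; exact Nb_self hr hs hc
  | succ k ih =>
    intro j
    have hp := W_path (mv := mv) hs hc k
    rcases (by omega : j % 3 = 0 ∨ j % 3 = 1 ∨ j % 3 = 2) with h | h | h
    · rw [W, W, if_neg (by omega), if_pos (by omega), show (j+1)/3 = j/3 by omega]
      exact Nb_app hr hs (hp _) _
    · rw [W, W, if_pos (by omega), if_neg (by omega), show (j+1)/3 = j/3 by omega]
      exact (Nb_app hr hs (hp _) _).symm hs
    · rw [W, W, if_neg (by omega), if_neg (by omega), show (j+1)/3 = j/3 + 1 by omega]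
      exact ih _

theorem Nb_same (hr : ∀ x, A x x) (hs : ∀ x y, A x y → A y x) (hc : PathW A c) (k : ℕ) (j j' : ℤ)
    (h1 : j ≤ j' + 1) (h2 : j' ≤ j + 1) : Nb A (W A c mv k j) (W A c mv k j') := by
  rcases (by omega : j = j' ∨ j = j' + 1 ∨ j' = j + 1) with rfl | rfl | rfl
  · exact Nb_self hr hs (W_path hs hc _ _)
  · exact (Nb_adj hr hs hc k _).symm hs
  · exact Nb_adj hr hs hc k _

theorem Nb_down (hr : ∀ x, A x x) (hs : ∀ x y, A x y → A y x) (hc : PathW A c) (k : ℕ) (j j' : ℤ)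
    (h1 : 3 * j ≤ j' + 1) (h2 : j' ≤ 3 * j + 3) : Nb A (W A c mv k j) (W A c mv (k+1) j') := by
  by_cases h : j' % 3 = 1
  · rw [W, if_pos h, show j'/3 = j by omega]
    exact Nb_app hr hs (W_path hs hc _ _) _
  · rw [W, if_neg h]
    exact Nb_same hr hs hc k _ _ (by omega) (by omega)

noncomputable def wd (A : X → X → Prop) (c : ℕ → X) (mv : ℕ → ℕ × X) (p : ℤ × ℤ × ℤ) : X :=
  W A c mv p.2.1.toNat p.1 p.2.2.toNat

def box (p : ℤ × ℤ × ℤ) : Set (ℝ × ℝ × ℝ) :=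
  Set.Icc ((p.1 : ℝ) / 3 ^ p.2.1.toNat) (((p.1 : ℝ) + 1) / 3 ^ p.2.1.toNat) ×ˢ
    (Set.Icc (p.2.1 : ℝ) ((p.2.1 : ℝ) + 1) ×ˢ Set.Icc (p.2.2 : ℝ) ((p.2.2 : ℝ) + 1))

theorem mem_box (p : ℤ × ℤ × ℤ) (x : ℝ × ℝ × ℝ) : x ∈ box p ↔
    ((p.1 : ℝ) ≤ x.1 * 3 ^ p.2.1.toNat ∧ x.1 * 3 ^ p.2.1.toNat ≤ (p.1 : ℝ) + 1) ∧
    ((p.2.1 : ℝ) ≤ x.2.1 ∧ x.2.1 ≤ (p.2.1 : ℝ) + 1) ∧ ((p.2.2 : ℝ) ≤ x.2.2 ∧ x.2.2 ≤ (p.2.2 : ℝ) + 1) := by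
  have h : (0:ℝ) < 3 ^ p.2.1.toNat := by positivity
  simp only [box, Set.mem_prod, Set.mem_Icc, div_le_iff₀ h, le_div_iff₀ h]

theorem box_closed (p : ℤ × ℤ × ℤ) : IsClosed (box p) :=
  isClosed_Icc.prod (isClosed_Icc.prod isClosed_Icc)

theorem box_preconn (p : ℤ × ℤ × ℤ) : IsPreconnected (box p) :=
  isPreconnected_Icc.prod (isPreconnected_Icc.prod isPreconnected_Icc)

theorem box_lf : LocallyFinite box := by
  intro x
  refine ⟨Set.Ioo (x.1-1) (x.1+1) ×ˢ (Set.Ioo (x.2.1-1) (x.2.1+1) ×ˢ Set.Ioo (x.2.2-1) (x.2.2+1)), ?_, ?_⟩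
  · refine prod_mem_nhds (Ioo_mem_nhds (by linarith) (by linarith))
      (prod_mem_nhds (Ioo_mem_nhds (by linarith) (by linarith)) (Ioo_mem_nhds (by linarith) (by linarith)))
  · let K := (⌈x.2.1 + 1⌉).toNat
    let T := (|x.1| + 1) * 3 ^ K
    refine Set.Finite.subset ((Set.finite_Icc ⌊-T-1⌋ ⌈T⌉).prod ((Set.finite_Icc ⌊x.2.1-2⌋ ⌈x.2.1+1⌉).prod
      (Set.finite_Icc ⌊x.2.2-2⌋ ⌈x.2.2+1⌉))) ?_
    rintro ⟨j, κ, s⟩ ⟨y, hy, hy'⟩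
    rw [mem_box] at hy
    obtain ⟨⟨a1, a2⟩, ⟨a3, a4⟩, a5, a6⟩ := hy
    obtain ⟨⟨b1, b2⟩, ⟨b3, b4⟩, b5, b6⟩ := hy'
    dsimp only at a1 a2 a3 a4 a5 a6
    have hκ : κ ≤ ⌈x.2.1 + 1⌉ := by
      have : (κ:ℝ) ≤ (⌈x.2.1+1⌉ : ℝ) := by linarith [Int.le_ceil (x.2.1+1)]
      exact_mod_cast this
    have hK : κ.toNat ≤ K := Int.toNat_le_toNat hκ
    have hy1 : |y.1| ≤ |x.1| + 1 := by
      have := abs_le.1 (le_refl |x.1|)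
      rw [abs_le]; constructor <;> linarith
    have hT : |y.1 * 3 ^ κ.toNat| ≤ T := by
      rw [abs_mul, abs_of_pos (show (0:ℝ) < 3 ^ κ.toNat by positivity)]
      exact mul_le_mul hy1 (pow_le_pow_right₀ (by norm_num) hK) (by positivity) (by positivity)
    rw [abs_le] at hT
    have fl : ∀ (z : ℤ) (r : ℝ), r ≤ z → ⌊r⌋ ≤ z := fun z r h => by
      have := (Int.floor_le r).trans h
      exact_mod_cast this
    have cl : ∀ (z : ℤ) (r : ℝ), (z:ℝ) ≤ r → z ≤ ⌈r⌉ := fun z r h => by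
      have := h.trans (Int.le_ceil r)
      exact_mod_cast this
    refine ⟨⟨fl _ _ (by linarith), cl _ _ (by linarith)⟩, ⟨fl _ _ (by linarith), hκ⟩,
      ⟨fl _ _ (by linarith), cl _ _ (by linarith)⟩⟩

theorem box_adj (hr : ∀ x, A x x) (hs : ∀ x y, A x y → A y x) (hc : PathW A c)
    (p q : ℤ × ℤ × ℤ) (x : ℝ × ℝ × ℝ) (hp : x ∈ box p) (hq : x ∈ box q) :
    A (wd A c mv p) (wd A c mv q) := by
  wlog hpq : p.2.1 ≤ q.2.1 generalizing p q
  · exact hs _ _ (this q p hq hp (le_of_not_ge hpq))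
  obtain ⟨j, κ, s⟩ := p
  obtain ⟨j', κ', s'⟩ := q
  rw [mem_box] at hp hq
  obtain ⟨⟨a1, a2⟩, ⟨a3, a4⟩, a5, a6⟩ := hp
  obtain ⟨⟨b1, b2⟩, ⟨b3, b4⟩, b5, b6⟩ := hq
  dsimp only at *
  have e1 : s ≤ s' + 1 := by exact_mod_cast a5.trans b6
  have e2 : s' ≤ s + 1 := by exact_mod_cast b5.trans a6
  have e3 : κ' ≤ κ + 1 := by exact_mod_cast b3.trans a4
  have hss : s.toNat = s'.toNat ∨ s.toNat = s'.toNat + 1 ∨ s'.toNat = s.toNat + 1 := by omega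
  unfold wd
  dsimp only
  by_cases h : κ'.toNat = κ.toNat
  · rw [h] at b1 b2 ⊢
    exact Nb_same hr hs hc _ _ _ (by exact_mod_cast a1.trans b2) (by exact_mod_cast b1.trans a2) _ _ hss
  · have h' : κ'.toNat = κ.toNat + 1 := by omega
    rw [h', pow_succ] at b1 b2
    rw [h']
    refine Nb_down hr hs hc _ _ _ ?_ ?_ _ _ hss
    · have : (3:ℝ) * j ≤ j' + 1 := by linarith
      exact_mod_cast this
    · have : (j':ℝ) ≤ 3 * j + 3 := by linarith
      exact_mod_cast this

theorem box_vert (j κ s : ℤ) : (box (j, κ, s) ∩ box (j, κ, s+1)).Nonempty := by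
  refine ⟨((j:ℝ) / 3 ^ κ.toNat, κ, s + 1), ?_, ?_⟩ <;> rw [mem_box] <;> dsimp only <;>
    rw [div_mul_cancel₀ _ (by positivity)] <;> push_cast <;> norm_num

theorem box_depth (j : ℤ) (k : ℕ) (s r : ℤ) (h0 : 0 ≤ r) (h3 : r < 3) :
    (box (j, (k:ℤ), s) ∩ box (3*j+r, ((k+1:ℕ):ℤ), s)).Nonempty := by
  have h0' : (0:ℝ) ≤ r := by exact_mod_cast h0
  have h3' : (r:ℝ) ≤ 3 := by exact_mod_cast h3.le
  refine ⟨((3*j+r:ℝ) / 3 ^ (k+1), (k:ℝ)+1, s), ?_, ?_⟩ <;> rw [mem_box] <;> dsimp only <;>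
    rw [Int.toNat_natCast]
  · rw [show (3*j+r:ℝ) / 3 ^ (k+1) * 3 ^ k = (3*j+r)/3 by field_simp; ring]
    push_cast
    refine ⟨⟨by linarith, by linarith⟩, ⟨by linarith, by linarith⟩, by linarith, by linarith⟩
  · rw [div_mul_cancel₀ _ (by positivity)]
    push_cast
    refine ⟨⟨by linarith, by linarith⟩, ⟨by linarith, by linarith⟩, by linarith, by linarith⟩

theorem box_hor (j κ s : ℤ) : (box (j, κ, s) ∩ box (j+1, κ, s)).Nonempty := by
  refine ⟨(((j:ℝ) + 1) / 3 ^ κ.toNat, κ, s), ?_, ?_⟩ <;> rw [mem_box] <;> dsimp only <;>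
    rw [div_mul_cancel₀ _ (by positivity)] <;> push_cast <;> norm_num

theorem box_neg (j κ s : ℤ) (h : κ + 1 ≤ 0) : (box (j, κ, s) ∩ box (j, κ+1, s)).Nonempty := by
  refine ⟨((j:ℝ), κ + 1, s), ?_, ?_⟩ <;> rw [mem_box] <;> dsimp only
  · rw [show κ.toNat = 0 by omega]; norm_num
  · rw [show (κ+1).toNat = 0 by omega]; norm_num

theorem box_exists (x : ℝ × ℝ × ℝ) : ∃ p, x ∈ box p := by
  refine ⟨(⌊x.1 * 3 ^ (⌊x.2.1⌋).toNat⌋, ⌊x.2.1⌋, ⌊x.2.2⌋), ?_⟩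
  rw [mem_box]
  exact ⟨⟨Int.floor_le _, (Int.lt_floor_add_one _).le⟩, ⟨Int.floor_le _, (Int.lt_floor_add_one _).le⟩,
    Int.floor_le _, (Int.lt_floor_add_one _).le⟩

theorem box_int (t : ℤ) (p : ℤ × ℤ × ℤ) : ((1/2 : ℝ), (1/2 : ℝ), (t:ℝ) + 1/2) ∈ box p ↔ p = (0, 0, t) := by
  rw [mem_box]
  constructor
  · obtain ⟨j, κ, s⟩ := p
    rintro ⟨⟨a1, a2⟩, ⟨a3, a4⟩, a5, a6⟩
    dsimp only at *
    have u : ∀ z y : ℤ, (z:ℝ) ≤ y + 1/2 → (y:ℝ) + 1/2 ≤ z + 1 → z = y := by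
      intro z y h1 h2
      have h3 : (z:ℝ) < y + 1 := by linarith
      have h4 : (y:ℝ) < z + 1 := by linarith
      have h5 : z < y + 1 := by exact_mod_cast h3
      have h6 : y < z + 1 := by exact_mod_cast h4
      omega
    have hκ := u κ 0 (by push_cast; linarith) (by push_cast; linarith)
    subst hκ
    have hj := u j 0 (by norm_num at a1 ⊢; linarith) (by norm_num at a2 ⊢; linarith)
    rw [hj, u s t a5 a6]
  · rintro rfl
    norm_num
end geom
section realize
variable {X : Type*} {A : X → X → Prop}

/-- overlap relation -/
def Ov (G : X → Prop) (f : ℤ × ℤ × ℤ → X) (p q : ℤ × ℤ × ℤ) : Prop :=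
  (box p ∩ box q).Nonempty ∧ G (f p) ∧ G (f q)

theorem Ov.symm {G : X → Prop} {f : ℤ × ℤ × ℤ → X} {p q : ℤ × ℤ × ℤ} (h : Ov G f p q) : Ov G f q p :=
  ⟨by rw [Set.inter_comm]; exact h.1, h.2.2, h.2.1⟩

theorem V_preconn {c : ℕ → X} {mv : ℕ → ℕ × X} {G : X → Prop}
    (hr : ∀ x, A x x) (hs : ∀ x y, A x y → A y x) (hc : PathW A c)
    (hrich : ∀ (N : ℕ) (β : ℕ → X) (l : ℕ), β 0 = c N →
      (∀ k < l, A (β k) (β (k+1))) → ∀ K, ∃ m ≥ K, N < m ∧ (∀ k, N + k < m → c (m+k) = c (m-1-k)) ∧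
        ∀ k ≤ l, c (2*m-1-N+k) = β k)
    (hmv : ∀ p K, ∃ n ≥ K, mv n = p)
    (hsc : ∀ f g : ℕ → X, PathW A f → PathW A g → f 0 = g 0 → ∀ (K : ℕ) (o : X),
      (∀ k ≥ K, f k = o) → (∀ k ≥ K, g k = o) → Hom A f g)
    (hGc : ∀ a b, G a → G b → ReflTransGen (fun x y => G x ∧ G y ∧ A x y) a b) :
    IsPreconnected (⋃ p ∈ {p | G (wd A c mv p)}, box p) := by
  have hsym : ∀ p q, ReflTransGen (Ov G (wd A c mv)) p q → ReflTransGen (Ov G (wd A c mv)) q p :=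
    fun p q h => by
      induction h with
      | refl => exact ReflTransGen.refl
      | tail _ h2 ih => exact ReflTransGen.head h2.symm ih
  let R : ℕ × ℤ × ℕ → ℕ × ℤ × ℕ → Prop := fun x y =>
    ReflTransGen (Ov G (wd A c mv)) (x.2.1, (x.1:ℤ), (x.2.2:ℤ)) (y.2.1, (y.1:ℤ), (y.2.2:ℤ))
  have hR0 : ∀ x, R x x := fun x => ReflTransGen.refl
  have hRs : ∀ x y, R x y → R y x := fun x y h => hsym _ _ h
  have hRt : ∀ x y z, R x y → R y z → R x z := fun x y z h h' => ReflTransGen.trans h h'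
  have wdn : ∀ (k : ℕ) (j : ℤ) (t : ℕ), wd A c mv (j, (k:ℤ), (t:ℤ)) = W A c mv k j t := by
    intro k j t; simp [wd]
  have h1 : ∀ k j t, G (W A c mv k j t) → G (W A c mv k j (t+1)) → R (k, j, t) (k, j, t+1) := by
    intro k j t a b
    refine ReflTransGen.single ⟨?_, by rw [wdn]; exact a, by rw [wdn]; exact b⟩
    have := box_vert j k t
    simpa using this
  have h2 : ∀ k j t r, 0 ≤ r → r < 3 → G (W A c mv k j t) → G (W A c mv (k+1) (3*j+r) t) →
      R (k, j, t) (k+1, 3*j+r, t) := by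
    intro k j t r hr0 hr3 a b
    exact ReflTransGen.single ⟨box_depth j k t r hr0 hr3, by rw [wdn]; exact a, by rw [wdn]; exact b⟩
  have h3 : ∀ j t, G (c t) → R (0, j, t) (0, j+1, t) := by
    intro j t a
    exact ReflTransGen.single ⟨box_hor j _ t, by rw [wdn]; exact a, by rw [wdn]; exact a⟩
  have hneg1 : ∀ (m : ℕ) (j s : ℤ), G (wd A c mv (j, -(m:ℤ), s)) →
      ReflTransGen (Ov G (wd A c mv)) (j, -(m:ℤ), s) (j, 0, s) := by
    intro m
    induction m with
    | zero => intro j s _; exact ReflTransGen.refl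
    | succ m ih =>
      intro j s h
      have e : wd A c mv (j, -((m+1:ℕ):ℤ), s) = wd A c mv (j, -(m:ℤ), s) := by
        simp only [wd]
        rw [show (-((m+1:ℕ):ℤ)).toNat = 0 by omega, show (-(m:ℤ)).toNat = 0 by omega]
      refine ReflTransGen.head ⟨?_, h, by rw [← e]; exact h⟩ (ih j s (by rw [← e]; exact h))
      have := box_neg j (-((m+1:ℕ):ℤ)) s (by omega)
      rwa [show -((m+1:ℕ):ℤ) + 1 = -(m:ℤ) by omega] at this
  have hneg2 : ∀ (m : ℕ) (j κ : ℤ), G (wd A c mv (j, κ, -(m:ℤ))) →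
      ReflTransGen (Ov G (wd A c mv)) (j, κ, -(m:ℤ)) (j, κ, 0) := by
    intro m
    induction m with
    | zero => intro j s _; exact ReflTransGen.refl
    | succ m ih =>
      intro j κ h
      have e : wd A c mv (j, κ, -((m+1:ℕ):ℤ)) = wd A c mv (j, κ, -(m:ℤ)) := by
        simp only [wd]
        rw [show (-((m+1:ℕ):ℤ)).toNat = 0 by omega, show (-(m:ℤ)).toNat = 0 by omega]
      refine ReflTransGen.head ⟨?_, h, by rw [← e]; exact h⟩ (ih j κ (by rw [← e]; exact h))
      have := box_vert j κ (-((m+1:ℕ):ℤ))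
      rwa [show -((m+1:ℕ):ℤ) + 1 = -(m:ℤ) by omega] at this
  have hpos : ∀ j κ s : ℤ, G (wd A c mv (j, κ, s)) → ReflTransGen (Ov G (wd A c mv)) (j, κ, s)
      (j, (κ.toNat : ℤ), (s.toNat : ℤ)) := by
    intro j κ s h
    have st1 : ReflTransGen (Ov G (wd A c mv)) (j, κ, s) (j, (κ.toNat : ℤ), s) := by
      rcases le_total 0 κ with h0 | h0
      · rw [Int.toNat_of_nonneg h0]
      · obtain ⟨m, hm⟩ : ∃ m : ℕ, κ = -(m:ℤ) := ⟨(-κ).toNat, by omega⟩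
        rw [show (κ.toNat : ℤ) = 0 by omega]
        subst hm
        exact hneg1 m j s h
    refine st1.trans ?_
    have h' : G (wd A c mv (j, (κ.toNat : ℤ), s)) := by
      simp only [wd, Int.toNat_natCast] at h ⊢; exact h
    rcases le_total 0 s with h0 | h0
    · rw [Int.toNat_of_nonneg h0]
    · obtain ⟨m, hm⟩ : ∃ m : ℕ, s = -(m:ℤ) := ⟨(-s).toNat, by omega⟩
      rw [show (s.toNat : ℤ) = 0 by omega]
      subst hm
      exact hneg2 m j _ h'
  have hb : ∀ p, G (wd A c mv p) → ∃ b, G (c b) ∧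
      ReflTransGen (Ov G (wd A c mv)) p (0, 0, (b:ℤ)) := by
    rintro ⟨j, κ, s⟩ h
    obtain ⟨b, hb, hR⟩ := to_base hr hs hc hrich hmv hR0 hRs hRt h1 h2 h3 κ.toNat j s.toNat h
    exact ⟨b, hb, (hpos j κ s h).trans hR⟩
  refine IsPreconnected.biUnion_of_reflTransGen (fun p _ => box_preconn p) ?_
  intro p hp q hq
  obtain ⟨b, hb1, hb2⟩ := hb p hp
  obtain ⟨b', hb1', hb2'⟩ := hb q hq
  have hbb : ReflTransGen (Ov G (wd A c mv)) (0, 0, (b:ℤ)) (0, 0, (b':ℤ)) := by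
    rcases le_total b b' with h | h
    · exact base_conn (R := R) hr hs hc hrich hmv hsc hGc hR0 hRs hRt h1 h2 b b' h hb1 hb1'
    · exact hsym _ _ (base_conn (R := R) hr hs hc hrich hmv hsc hGc hR0 hRs hRt h1 h2 b' b h hb1' hb1)
  refine ReflTransGen.mono ?_ _ _ ((hb2.trans hbb).trans (hsym _ _ hb2'))
  intro x y h
  exact ⟨h.1, h.2.1⟩

theorem realize {X : Type*} [Countable X] [Nonempty X] {n : ℕ} {A : X → X → Prop}
    (hr : ∀ x, A x x) (hs : ∀ x y, A x y → A y x) (lab : X → Set (Fin n))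
    (hlab : ∀ x y, A x y → lab x ⊆ lab y ∨ lab y ⊆ lab x) (hA : ∀ a b, ReflTransGen A a b)
    (hsc : ∀ f g : ℕ → X, PathW A f → PathW A g → f 0 = g 0 → ∀ (K : ℕ) (o : X),
      (∀ k ≥ K, f k = o) → (∀ k ≥ K, g k = o) → Hom A f g)
    (hGc : ∀ i a b, i ∈ lab a → i ∈ lab b →
      ReflTransGen (fun x y => i ∈ lab x ∧ i ∈ lab y ∧ A x y) a b) :
    ∃ V : Fin n → Set (ℝ × ℝ × ℝ), (∀ i, IsClosed (V i) ∧ IsPreconnected (V i)) ∧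
      ∀ σ, (∃ a, σ = lab a) ↔ ∃ x, σ = {i | x ∈ V i} := by
  obtain ⟨x0⟩ := ‹Nonempty X›
  obtain ⟨c, c0, hc, hrich⟩ := exists_rich hr hs x0
  have : Nonempty (ℕ × X) := ⟨(0, x0)⟩
  obtain ⟨mv, hmv⟩ := inf_often (ℕ × X)
  refine ⟨fun i => ⋃ p ∈ {p | i ∈ lab (wd A c mv p)}, box p, fun i => ⟨?_, ?_⟩, fun σ => ⟨?_, ?_⟩⟩
  · beta_reduce
    rw [Set.biUnion_eq_iUnion]
    exact (box_lf.comp_injective Subtype.val_injective).isClosed_iUnion fun p => box_closed _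
  · exact V_preconn (G := fun x => i ∈ lab x) hr hs hc hrich hmv hsc (hGc i)
  · rintro ⟨a, rfl⟩
    obtain ⟨q, K, q0, qK, -, qp⟩ := seq_of_rtg (G := fun _ => True) hr x0 a
      (ReflTransGen.mono (fun x y h => ⟨trivial, trivial, h⟩) _ _ (hA x0 a)) trivial
    obtain ⟨m, -, -, -, hm⟩ := hrich 0 q K (by rw [q0, c0]) (fun k _ => qp k) 0
    have ht := hm K le_rfl
    rw [qK K le_rfl] at ht
    refine ⟨(1/2, 1/2, ((2*m-1-0+K : ℕ) : ℤ) + 1/2), ?_⟩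
    ext i
    simp only [Set.mem_ofPred_eq, Set.mem_iUnion, exists_prop, box_int]
    simp only [exists_eq_right]
    rw [show wd A c mv (0, 0, ((2*m-1-0+K : ℕ) : ℤ)) = a by rw [← ht]; simp only [wd, Int.toNat_natCast]; rfl]
  · rintro ⟨x, rfl⟩
    have hfin : ((fun p => lab (wd A c mv p)) '' {p | x ∈ box p}).Finite := Set.toFinite _
    obtain ⟨p0, hp0⟩ := box_exists x
    obtain ⟨_, hmax⟩ := hfin.exists_maximal ⟨_, p0, hp0, rfl⟩
    obtain ⟨⟨p, hp, rfl⟩, hmax⟩ := hmax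
    refine ⟨wd A c mv p, ?_⟩
    ext i
    simp only [Set.mem_ofPred_eq, Set.mem_iUnion, exists_prop]
    constructor
    · rintro ⟨q, hq, hxq⟩
      rcases hlab _ _ (box_adj (mv := mv) hr hs hc p q x hp hxq) with h | h
      · exact hmax ⟨q, hxq, rfl⟩ h hq
      · exact h hq
    · intro h
      exact ⟨p, h, hp⟩
end realize
theorem main_pi {d n : ℕ} (U : Fin n → Set (Fin d → ℝ)) (hU : ∀ i, IsClosed (U i) ∧ IsPreconnected (U i)) :
    ∃ V : Fin n → Set (ℝ × ℝ × ℝ), (∀ i, IsClosed (V i) ∧ IsPreconnected (V i)) ∧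
      ∀ σ, (∃ y, σ = {i | y ∈ U i}) ↔ ∃ x, σ = {i | x ∈ V i} := by
  obtain ⟨B, hBc, hB, hbas⟩ := exists_basis U fun i => (hU i).1
  have : Countable B := hBc.to_subtype
  let O : B → Set (Fin d → ℝ) := fun a => a.1
  have hO : ∀ a, IsOpen (O a) := fun a => (hB a.1 a.2).1
  have hne : ∀ a, (O a).Nonempty := fun a => (hB a.1 a.2).2.2.1
  have hbas' : IsBas O := by
    intro y N hN
    obtain ⟨o, ho, h1, h2, -⟩ := hbas y N hN
    exact ⟨⟨o, ho⟩, h1, h2⟩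
  have : Nonempty B := by
    obtain ⟨o, ho, -⟩ := hbas 0 Set.univ Filter.univ_mem
    exact ⟨⟨o, ho⟩⟩
  obtain ⟨V, hV, hσ⟩ := realize (A := Adj O) (adj_refl O) (adj_symm O) (fun a => {i | (U i ∩ O a).Nonempty})
    (by
      rintro x y (h | h)
      · exact Or.inl fun i hi => hi.mono (Set.inter_subset_inter_right _ h)
      · exact Or.inr fun i hi => hi.mono (Set.inter_subset_inter_right _ h))
    (fun a b => ReflTransGen.mono (fun x y h => h.2.2) _ _
      (G_conn hO hbas' isPreconnected_univ a b (by simpa using hne a) (by simpa using hne b)))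
    (simply_conn hO hbas' (fun a => (hB a.1 a.2).2.1) hne)
    (fun i a b ha hb => G_conn hO hbas' (hU i).2 a b ha hb)
  refine ⟨V, hV, fun σ => ?_⟩
  rw [← hσ]
  constructor
  · rintro ⟨y, rfl⟩
    obtain ⟨o, ho, -, -, h⟩ := hbas y Set.univ Filter.univ_mem
    exact ⟨⟨o, ho⟩, h.symm⟩
  · rintro ⟨a, rfl⟩
    exact (hB a.1 a.2).2.2.2

end CC

/-- Every connected code (realizable by closed preconnected sets in some dimension
`d ≥ 1`) is realizable by closed preconnected sets in dimension `3`; in particular its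
minimal embedding dimension with respect to connected sets is at most `3`. -/
theorem connected_code_realizable_dim3 {n : ℕ} (hn : 1 ≤ n)
    (C : Set (Set (Fin n)))
    (hconn : ∃ d : ℕ, 1 ≤ d ∧ ∃ U : Fin n → Set (EuclideanSpace ℝ (Fin d)),
        (∀ i, IsClosed (U i) ∧ IsPreconnected (U i)) ∧ C = RFCode U) :
    ∃ V : Fin n → Set (EuclideanSpace ℝ (Fin 3)),
      (∀ i, IsClosed (V i) ∧ IsPreconnected (V i)) ∧ C = RFCode V := by
  obtain ⟨d, -, U, hU, rfl⟩ := hconn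
  let e : EuclideanSpace ℝ (Fin d) ≃L[ℝ] (Fin d → ℝ) := EuclideanSpace.equiv (Fin d) ℝ
  let g : EuclideanSpace ℝ (Fin 3) ≃L[ℝ] (ℝ × ℝ × ℝ) := ContinuousLinearEquiv.ofFinrankEq (by simp)
  obtain ⟨V, hV, h⟩ := CC.main_pi (fun i => e.toHomeomorph '' U i) (fun i =>
    ⟨e.toHomeomorph.isClosed_image.2 (hU i).1, e.toHomeomorph.isPreconnected_image.2 (hU i).2⟩)
  refine ⟨fun i => g.toHomeomorph ⁻¹' V i, fun i =>
    ⟨(hV i).1.preimage g.toHomeomorph.continuous, g.toHomeomorph.isPreconnected_preimage.2 (hV i).2⟩, ?_⟩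
  ext σ
  have h1 : σ ∈ RFCode U ↔ ∃ y, σ = {i | y ∈ e.toHomeomorph '' U i} := by
    constructor
    · rintro ⟨x, rfl⟩
      exact ⟨e.toHomeomorph x, by ext i; simp⟩
    · rintro ⟨y, rfl⟩
      obtain ⟨x, rfl⟩ := e.toHomeomorph.surjective y
      exact ⟨x, by ext i; simp⟩
  rw [h1, h]
  constructor
  · rintro ⟨x, rfl⟩
    obtain ⟨z, rfl⟩ := g.toHomeomorph.surjective x
    exact ⟨z, rfl⟩
  · rintro ⟨z, rfl⟩
    exact ⟨g.toHomeomorph z, rfl⟩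
end

section
/- Let n ≥ 1 and let 𝒞 be a set of subsets of Fin n with ∅ ∈ 𝒞 that satisfies the chain condition: for every σ, τ ∈ 𝒞 and every i ∈ σ ∩ τ there exist m ≥ 1 and pairwise distinct codewords ν₁, …, ν_m ∈ 𝒞 such that ν₁ = σ, ν_m = τ, i ∈ ν_j for every j ∈ [m], and for every j ∈ [m−1] either ν_j ⊆ ν_{j+1} or ν_{j+1} ⊆ ν_j. Then there exists a family U : Fin n → Set (EuclideanSpace ℝ (Fin 3)) of open preconnected sets with 𝒞 = 𝒞(U). -/
namespace ChainAux

abbrev E3 := EuclideanSpace ℝ (Fin 3)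

def slab (a : Fin 3) (k : ℕ) : Set E3 := {x | |x a - k| < 1/3}
def low : Set E3 := {x | x 2 < 0}
def high : Set E3 := {x | 0 < x 2}

lemma isOpen_slab (a k) : IsOpen (slab a k) :=
  isOpen_lt (by fun_prop) (by fun_prop)
lemma isOpen_low : IsOpen low := isOpen_lt (by fun_prop) (by fun_prop)
lemma isOpen_high : IsOpen high := isOpen_lt (by fun_prop) (by fun_prop)

lemma convex_slab (a k) : Convex ℝ (slab a k) := by
  intro x hx y hy s t hs ht hst
  simp only [slab, Set.mem_ofPred_eq, abs_lt, PiLp.add_apply, PiLp.smul_apply, smul_eq_mul] at *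
  obtain rfl : t = 1 - s := by linarith
  rcases hs.eq_or_lt with rfl | hs
  · constructor <;> linarith
  · constructor <;> nlinarith
lemma convex_low : Convex ℝ low := by
  intro x hx y hy s t hs ht hst
  simp only [low, Set.mem_ofPred_eq, PiLp.add_apply, PiLp.smul_apply, smul_eq_mul] at *
  obtain rfl : t = 1 - s := by linarith
  rcases hs.eq_or_lt with rfl | hs
  · linarith
  · nlinarith
lemma convex_high : Convex ℝ high := by
  intro x hx y hy s t hs ht hst
  simp only [high, Set.mem_ofPred_eq, PiLp.add_apply, PiLp.smul_apply, smul_eq_mul] at *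
  obtain rfl : t = 1 - s := by linarith
  rcases hs.eq_or_lt with rfl | hs
  · linarith
  · nlinarith

lemma slab_eq {a k l} {x : E3} (h : x ∈ slab a k) (h' : x ∈ slab a l) : k = l := by
  simp only [slab, Set.mem_ofPred_eq, abs_lt] at *
  have h1 : (k : ℝ) < l + 1 := by linarith
  have h2 : (l : ℝ) < k + 1 := by linarith
  norm_cast at h1 h2
  omega

/-- The region attached to vertex `k`, with `A` the set of its neighbours. -/
def W (A : Set ℕ) (k : ℕ) : Set E3 :=
  (⋃ j ∈ A, ((slab 1 k ∩ low) ∪ (slab 0 j ∩ slab 1 k))) ∪ (slab 0 k ∩ high)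

lemma isOpen_W (A k) : IsOpen (W A k) := by
  refine IsOpen.union (isOpen_biUnion fun j _ => ?_) ((isOpen_slab _ _).inter isOpen_high)
  exact ((isOpen_slab _ _).inter isOpen_low).union ((isOpen_slab _ _).inter (isOpen_slab _ _))

lemma mem_slab0 (j k : ℕ) (c : ℝ) : (!₂[(j:ℝ), (k:ℝ), c] : E3) ∈ slab 0 j := by simp [slab]
lemma mem_slab1 (b : ℝ) (k : ℕ) (c : ℝ) : (!₂[b, (k:ℝ), c] : E3) ∈ slab 1 k := by simp [slab]
lemma mem_low (a b : ℝ) : (!₂[a, b, -1] : E3) ∈ low := by simp [low]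
lemma mem_high (a b : ℝ) : (!₂[a, b, 1] : E3) ∈ high := by simp [high]

lemma isPreconnected_W {A k} (hk : k ∈ A) : IsPreconnected (W A k) := by
  refine IsPreconnected.union !₂[(k:ℝ), (k:ℝ), 1] ?_ ⟨mem_slab0 _ _ _, mem_high _ _⟩ ?_
    ((convex_slab _ _).inter convex_high).isPreconnected
  · exact Set.mem_biUnion hk (Or.inr ⟨mem_slab0 _ _ _, mem_slab1 _ _ _⟩)
  · rw [← Set.sUnion_image]
    refine isPreconnected_sUnion !₂[(k:ℝ), (k:ℝ), -1] _ ?_ ?_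
    · rintro _ ⟨j, hj, rfl⟩
      exact Or.inl ⟨mem_slab1 _ _ _, mem_low _ _⟩
    · rintro _ ⟨j, hj, rfl⟩
      exact IsPreconnected.union !₂[(j:ℝ), (k:ℝ), -1] ⟨mem_slab1 _ _ _, mem_low _ _⟩
        ⟨mem_slab0 _ _ _, mem_slab1 _ _ _⟩
        ((convex_slab _ _).inter convex_low).isPreconnected
        ((convex_slab _ _).inter (convex_slab _ _)).isPreconnected

lemma mem_W {A k} {x : E3} (h : x ∈ W A k) :
    (x ∈ slab 1 k ∧ x ∈ low) ∨ (∃ j ∈ A, x ∈ slab 0 j ∧ x ∈ slab 1 k) ∨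
      (x ∈ slab 0 k ∧ x ∈ high) := by
  simp only [W, Set.mem_union, Set.mem_iUnion, Set.mem_inter_iff] at h
  rcases h with ⟨j, hj, h | h⟩ | h
  · exact Or.inl h
  · exact Or.inr (Or.inl ⟨j, hj, h⟩)
  · exact Or.inr (Or.inr h)

lemma W_inter {A B k l} {x : E3} (h : x ∈ W A k) (h' : x ∈ W B l) :
    k = l ∨ l ∈ A ∨ k ∈ B := by
  have lh : x ∈ low → x ∈ high → False := by
    intro h1 h2; simp only [low, high, Set.mem_ofPred_eq] at h1 h2; linarith
  rcases mem_W h with ⟨a, b⟩ | ⟨j, hj, a, b⟩ | ⟨a, b⟩ <;>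
  rcases mem_W h' with ⟨c, d⟩ | ⟨i, hi, c, d⟩ | ⟨c, d⟩
  · exact Or.inl (slab_eq a c)
  · exact Or.inl (slab_eq a d)
  · exact (lh b d).elim
  · exact Or.inl (slab_eq b c)
  · exact Or.inl (slab_eq b d)
  · exact Or.inr (Or.inl (slab_eq c a ▸ hj))
  · exact (lh d b).elim
  · exact Or.inr (Or.inr (slab_eq a c ▸ hi))
  · exact Or.inl (slab_eq a c)

lemma W_nonempty_inter {A B k l} (hl : l ∈ A) : (W A k ∩ W B l).Nonempty :=
  ⟨!₂[(l:ℝ), (k:ℝ), 1], Or.inl (Set.mem_biUnion hl (Or.inr ⟨mem_slab0 _ _ _, mem_slab1 _ _ _⟩)),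
    Or.inr ⟨mem_slab0 _ _ _, mem_high _ _⟩⟩

/-- A private point. -/
noncomputable def priv (k : ℕ) : E3 := !₂[1/2, (k:ℝ), -1]

lemma priv_mem {A k} (hk : k ∈ A) : priv k ∈ W A k :=
  Or.inl (Set.mem_biUnion hk (Or.inl ⟨mem_slab1 _ _ _, mem_low _ _⟩))

lemma priv_eq {A k l} (h : priv k ∈ W A l) : k = l := by
  rcases mem_W h with ⟨a, b⟩ | ⟨j, hj, a, b⟩ | ⟨a, b⟩
  · exact slab_eq (mem_slab1 _ _ _) a
  · exact slab_eq (mem_slab1 _ _ _) b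
  · simp [high, priv] at b; linarith

end ChainAux

open ChainAux in
/-- Every code containing `∅` and satisfying the chain condition is realizable by
open preconnected sets in dimension `3`. -/
theorem realizable_dim3_open_of_chainCondition {n : ℕ} (hn : 1 ≤ n)
    (C : Set (Set (Fin n))) (hC : (∅ : Set (Fin n)) ∈ C) (hchain : ChainCondition C) :
    ∃ U : Fin n → Set (EuclideanSpace ℝ (Fin 3)),
      (∀ i, IsOpen (U i) ∧ IsPreconnected (U i)) ∧ C = RFCode U := by
  obtain ⟨e, he⟩ := exists_injective_nat (Set (Fin n))
  let A : Set (Fin n) → Set ℕ := fun σ => e '' {τ | σ ⊆ τ ∨ τ ⊆ σ}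
  have hA : ∀ σ τ, e τ ∈ A σ ↔ (σ ⊆ τ ∨ τ ⊆ σ) := fun σ τ => by
    simp [A, he.eq_iff]
  let V : Set (Fin n) → Set E3 := fun σ => W (A σ) (e σ)
  have hself : ∀ σ, e σ ∈ A σ := fun σ => (hA σ σ).2 (Or.inl subset_rfl)
  have hcomp : ∀ σ τ x, x ∈ V σ → x ∈ V τ → σ ⊆ τ ∨ τ ⊆ σ := by
    intro σ τ x h h'
    rcases W_inter h h' with h | h | h
    · exact Or.inl (he h).subset
    · exact (hA _ _).1 h
    · exact ((hA _ _).1 h).symm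
  let U : Fin n → Set E3 := fun i => ⋃ σ ∈ {σ | σ ∈ C ∧ i ∈ σ}, V σ
  have hU : ∀ x i, x ∈ U i ↔ ∃ σ ∈ C, i ∈ σ ∧ x ∈ V σ := by
    intro x i; simp [U, and_assoc]
  refine ⟨U, fun i => ⟨isOpen_biUnion fun σ _ => isOpen_W _ _, ?_⟩, ?_⟩
  · refine IsPreconnected.biUnion_of_reflTransGen (fun σ _ => isPreconnected_W (hself σ)) ?_
    rintro σ ⟨hσ, hiσ⟩ τ ⟨hτ, hiτ⟩
    obtain ⟨m, hm, ν, -, hνC, h0, h1, hi, hstep⟩ := hchain σ hσ τ hτ i ⟨hiσ, hiτ⟩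
    have key : ∀ k (hk : k < m), Relation.ReflTransGen
        (fun i_1 j => (V i_1 ∩ V j).Nonempty ∧ i_1 ∈ {σ | σ ∈ C ∧ i ∈ σ}) σ (ν ⟨k, hk⟩) := by
      intro k
      induction k with
      | zero => intro hk; rw [h0]
      | succ k ih =>
        intro hk
        refine (ih (by omega)).tail ⟨?_, hνC _, hi _⟩
        exact W_nonempty_inter ((hA _ _).2 (hstep ⟨k, by omega⟩ hk))
    rw [← h1]
    exact key _ _
  · ext σ
    constructor
    · intro hσ
      refine ⟨priv (e σ), ?_⟩
      ext i
      simp only [Set.mem_ofPred_eq, hU]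
      constructor
      · intro h; exact ⟨σ, hσ, h, priv_mem (hself σ)⟩
      · rintro ⟨τ, -, hi, h⟩
        rwa [he (priv_eq h)]
    · rintro ⟨x, rfl⟩
      by_cases hne : {τ | τ ∈ C ∧ x ∈ V τ}.Nonempty
      · obtain ⟨τ, hτ⟩ := (Set.toFinite {τ | τ ∈ C ∧ x ∈ V τ}).exists_maximal hne
        have : {i | x ∈ U i} = τ := by
          ext i
          simp only [Set.mem_ofPred_eq, hU]
          constructor
          · rintro ⟨ρ, hρ, hi, hx⟩
            rcases hcomp _ _ _ hx hτ.1.2 with h | h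
            · exact h hi
            · exact hτ.2 ⟨hρ, hx⟩ h hi
          · intro h; exact ⟨τ, hτ.1.1, h, hτ.1.2⟩
        rw [this]; exact hτ.1.1
      · have : {i | x ∈ U i} = ∅ := by
          ext i
          simp only [Set.mem_ofPred_eq, hU, Set.mem_empty_iff_false, iff_false]
          rintro ⟨ρ, hρ, hi, hx⟩
          exact hne ⟨ρ, hρ, hx⟩
        rw [this]; exact hC
end

section
/- Let n ≥ 1 and let 𝒞 be a set of subsets of Fin n with ∅ ∈ 𝒞. Then there exist d ≥ 1 and a family U : Fin n → Set (EuclideanSpace ℝ (Fin d)) of closed preconnected sets with 𝒞 = 𝒞(U) if and only if there exist d' ≥ 1 and a family V : Fin n → Set (EuclideanSpace ℝ (Fin d')) of open preconnected sets with 𝒞 = 𝒞(V). -/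
def RelC {n : ℕ} (C : Set (Set (Fin n))) (i : Fin n) (a b : Set (Fin n)) : Prop :=
  (a ⊆ b ∨ b ⊆ a) ∧ (a ∈ C ∧ i ∈ a) ∧ (b ∈ C ∧ i ∈ b)

def ConnC {n : ℕ} (C : Set (Set (Fin n))) : Prop :=
  ∀ i, ∀ σ ∈ C, ∀ τ ∈ C, i ∈ σ → i ∈ τ → Relation.ReflTransGen (RelC C i) σ τ

lemma RelC.symm {n : ℕ} {C : Set (Set (Fin n))} {i : Fin n} {a b : Set (Fin n)}
    (h : RelC C i a b) : RelC C i b a := ⟨h.1.symm, h.2.2, h.2.1⟩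

lemma connC_of {n d : ℕ} (U : Fin n → Set (EuclideanSpace ℝ (Fin d)))
    (H : ∀ i, ∀ S T : Set (Set (Fin n)),
      U i ⊆ (⋃ σ ∈ S, ⋂ j ∈ σ, U j) ∪ (⋃ σ ∈ T, ⋂ j ∈ σ, U j) →
      U i ∩ ((⋃ σ ∈ S, ⋂ j ∈ σ, U j) ∩ (⋃ σ ∈ T, ⋂ j ∈ σ, U j)) = ∅ →
      U i ⊆ (⋃ σ ∈ S, ⋂ j ∈ σ, U j) ∨ U i ⊆ (⋃ σ ∈ T, ⋂ j ∈ σ, U j)) :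
    ConnC (RFCode U) := by
  rintro i σ ⟨x, hx⟩ τ ⟨y, hy⟩ hiσ hiτ
  have hσC : σ ∈ RFCode U := ⟨x, hx⟩
  by_contra hcon
  set S : Set (Set (Fin n)) :=
    {ρ | (ρ ∈ RFCode U ∧ i ∈ ρ) ∧ Relation.ReflTransGen (RelC (RFCode U) i) σ ρ} with hS
  set T : Set (Set (Fin n)) :=
    {ρ | (ρ ∈ RFCode U ∧ i ∈ ρ) ∧ ¬ Relation.ReflTransGen (RelC (RFCode U) i) σ ρ} with hT
  have code : ∀ z, {j | z ∈ U j} ∈ RFCode U := fun z => ⟨z, rfl⟩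
  have memS : ∀ z ∈ U i, (z ∈ ⋃ σ ∈ S, ⋂ j ∈ σ, U j) →
      Relation.ReflTransGen (RelC (RFCode U) i) σ {j | z ∈ U j} := by
    intro z hz h
    simp only [Set.mem_iUnion, Set.mem_iInter] at h
    obtain ⟨ρ, hρ, h⟩ := h
    exact hρ.2.tail ⟨Or.inl h, hρ.1, code z, hz⟩
  have memT : ∀ z ∈ U i, (z ∈ ⋃ σ ∈ T, ⋂ j ∈ σ, U j) →
      ¬ Relation.ReflTransGen (RelC (RFCode U) i) σ {j | z ∈ U j} := by
    intro z hz h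
    simp only [Set.mem_iUnion, Set.mem_iInter] at h
    obtain ⟨ρ, hρ, h⟩ := h
    intro hr
    exact hρ.2 (hr.tail (RelC.symm ⟨Or.inl h, hρ.1, code z, hz⟩))
  have hxU : x ∈ U i := by rw [hx] at hiσ; exact hiσ
  have hyU : y ∈ U i := by rw [hy] at hiτ; exact hiτ
  have hc : U i ⊆ (⋃ σ ∈ S, ⋂ j ∈ σ, U j) ∪ (⋃ σ ∈ T, ⋂ j ∈ σ, U j) := by
    intro z hz
    by_cases hr : Relation.ReflTransGen (RelC (RFCode U) i) σ {j | z ∈ U j}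
    · left
      simp only [Set.mem_iUnion, Set.mem_iInter]
      exact ⟨_, ⟨⟨code z, hz⟩, hr⟩, fun j hj => hj⟩
    · right
      simp only [Set.mem_iUnion, Set.mem_iInter]
      exact ⟨_, ⟨⟨code z, hz⟩, hr⟩, fun j hj => hj⟩
  have hd : U i ∩ ((⋃ σ ∈ S, ⋂ j ∈ σ, U j) ∩ (⋃ σ ∈ T, ⋂ j ∈ σ, U j)) = ∅ := by
    ext z
    simp only [Set.mem_inter_iff, Set.mem_empty_iff_false, iff_false]
    rintro ⟨hz, h1, h2⟩
    exact memT z hz h2 (memS z hz h1)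
  rcases H i S T hc hd with h | h
  · have := memS y hyU (h hyU)
    rw [← hy] at this
    exact hcon this
  · have := memT x hxU (h hxU)
    rw [← hx] at this
    exact this .refl

lemma connC_open {n d : ℕ} (U : Fin n → Set (EuclideanSpace ℝ (Fin d)))
    (hU : ∀ i, IsOpen (U i) ∧ IsPreconnected (U i)) : ConnC (RFCode U) := by
  have key : ∀ S : Set (Set (Fin n)), IsOpen (⋃ σ ∈ S, ⋂ j ∈ σ, U j) := fun S =>
    isOpen_biUnion fun σ _ => (Set.toFinite σ).isOpen_biInter fun j _ => (hU j).1
  exact connC_of U fun i S T => isPreconnected_iff_subset_of_disjoint.1 (hU i).2 _ _ (key S) (key T)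

lemma connC_closed {n d : ℕ} (U : Fin n → Set (EuclideanSpace ℝ (Fin d)))
    (hU : ∀ i, IsClosed (U i) ∧ IsPreconnected (U i)) : ConnC (RFCode U) := by
  have key : ∀ S : Set (Set (Fin n)), IsClosed (⋃ σ ∈ S, ⋂ j ∈ σ, U j) := fun S =>
    (Set.toFinite S).isClosed_biUnion fun σ _ => isClosed_biInter fun j _ => (hU j).1
  exact connC_of U fun i S T =>
    isPreconnected_iff_subset_of_disjoint_closed.1 (hU i).2 _ _ (key S) (key T)

lemma preconn_of {n d : ℕ} {C : Set (Set (Fin n))} (hC : ConnC C) (i : Fin n)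
    (B : Set (Fin n) → Set (EuclideanSpace ℝ (Fin d)))
    (p : Set (Fin n) → EuclideanSpace ℝ (Fin d))
    (hs : ∀ σ ∈ C, i ∈ σ → p σ ∈ B σ ∧ StarConvex ℝ (p σ) (B σ))
    (hB : ∀ σ τ, RelC C i σ τ → (B σ ∩ B τ).Nonempty) :
    IsPreconnected (⋃ σ ∈ {σ | σ ∈ C ∧ i ∈ σ}, B σ) := by
  apply IsPreconnected.biUnion_of_reflTransGen
  · rintro σ ⟨h1, h2⟩
    obtain ⟨h3, h4⟩ := hs σ h1 h2
    exact (h4.isPathConnected h3).isConnected.isPreconnected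
  · rintro σ ⟨h1, h2⟩ τ ⟨h3, h4⟩
    exact Relation.ReflTransGen.mono (p := fun i_1 j => (B i_1 ∩ B j).Nonempty ∧ i_1 ∈ {σ | σ ∈ C ∧ i ∈ σ})
      (fun a b h => ⟨hB a b h, h.2.1⟩) σ τ (hC i σ h1 τ h3 h2 h4)

open Classical in
noncomputable def ptC {n d : ℕ} (e : Set (Fin n) ≃ Fin d) (S : Set (Set (Fin n))) (c : ℝ) :
    EuclideanSpace ℝ (Fin d) :=
  WithLp.toLp 2 (fun k => if e.symm k ∈ S then 1 else c)

lemma ptC_mem {n d : ℕ} (e : Set (Fin n) ≃ Fin d) {S : Set (Set (Fin n))} (c : ℝ)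
    {a : Set (Fin n)} (h : a ∈ S) : ptC e S c (e a) = 1 := by
  simp [ptC, h]

lemma ptC_not_mem {n d : ℕ} (e : Set (Fin n) ≃ Fin d) {S : Set (Set (Fin n))} (c : ℝ)
    {a : Set (Fin n)} (h : a ∉ S) : ptC e S c (e a) = c := by
  simp [ptC, h]

lemma open_of_conn {n : ℕ} (C : Set (Set (Fin n))) (h0 : ∅ ∈ C) (hC : ConnC C) :
    ∃ d' : ℕ, 1 ≤ d' ∧ ∃ V : Fin n → Set (EuclideanSpace ℝ (Fin d')),
        (∀ i, IsOpen (V i) ∧ IsPreconnected (V i)) ∧ C = RFCode V := by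
  classical
  let e := Fintype.equivFin (Set (Fin n))
  let W : Set (EuclideanSpace ℝ (Fin (Fintype.card (Set (Fin n))))) :=
    {x | ∀ a b, 0 ≤ x (e a) → 0 ≤ x (e b) → a ∈ C ∧ (a ⊆ b ∨ b ⊆ a)}
  let B : Set (Fin n) → Set (EuclideanSpace ℝ (Fin (Fintype.card (Set (Fin n))))) :=
    fun σ => W ∩ {x | 0 < x (e σ)}
  have hWo : IsOpen W := by
    have : W = ⋂ a, ⋂ b, {x | 0 ≤ x (e a) → 0 ≤ x (e b) → a ∈ C ∧ (a ⊆ b ∨ b ⊆ a)} := by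
      ext x; simp [W]
    rw [this]
    refine isOpen_iInter_of_finite fun a => isOpen_iInter_of_finite fun b => ?_
    by_cases h : a ∈ C ∧ (a ⊆ b ∨ b ⊆ a)
    · simp [h]
    · have : {x : EuclideanSpace ℝ (Fin (Fintype.card (Set (Fin n)))) |
          0 ≤ x (e a) → 0 ≤ x (e b) → a ∈ C ∧ (a ⊆ b ∨ b ⊆ a)}
          = {x | x (e a) < 0} ∪ {x | x (e b) < 0} := by
        ext x
        simp only [h, Set.mem_ofPred_eq, Set.mem_union, ← not_le]
        tauto
      rw [this]
      exact (isOpen_lt (by fun_prop) (by fun_prop)).union (isOpen_lt (by fun_prop) (by fun_prop))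
  have ptW : ∀ S : Set (Set (Fin n)), (∀ a ∈ S, ∀ b ∈ S, a ∈ C ∧ (a ⊆ b ∨ b ⊆ a)) →
      ptC e S (-1) ∈ W := by
    intro S hS a b ha hb
    by_cases h1 : a ∈ S
    · by_cases h2 : b ∈ S
      · exact hS a h1 b h2
      · rw [ptC_not_mem e _ h2] at hb; linarith
    · rw [ptC_not_mem e _ h1] at ha; linarith
  refine ⟨Fintype.card (Set (Fin n)), Fintype.card_pos, fun i => ⋃ σ ∈ {σ | σ ∈ C ∧ i ∈ σ}, B σ,
    fun i => ⟨?_, ?_⟩, ?_⟩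
  · exact isOpen_biUnion fun σ _ => hWo.inter (isOpen_lt (by fun_prop) (by fun_prop))
  · refine preconn_of hC i B (fun σ => ptC e {σ} (-1)) ?_ ?_
    · intro σ hσ hi
      refine ⟨⟨ptW _ ?_, ?_⟩, ?_⟩
      · rintro a rfl b rfl; exact ⟨hσ, Or.inl subset_rfl⟩
      · simp [ptC_mem e (-1) (Set.mem_singleton σ)]
      · rintro y ⟨hyW, hy⟩ s t hs ht hst
        have hy : 0 < y (e σ) := hy
        have key : ∀ a, 0 ≤ (s • ptC e {σ} (-1) + t • y) (e a) → 0 ≤ y (e a) := by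
          intro a ha
          by_cases h : a = σ
          · subst h; exact hy.le
          · have : ptC e {σ} (-1) (e a) = -1 := ptC_not_mem e _ (by simpa using h)
            simp [this] at ha
            by_contra hn
            push Not at hn
            rcases hs.eq_or_lt with h | h
            · have : t = 1 := by linarith
              subst this; subst h; linarith
            · nlinarith
        refine ⟨fun a b ha hb => hyW a b (key a ha) (key b hb), ?_⟩
        have : ptC e {σ} (-1) (e σ) = 1 := ptC_mem e _ rfl
        simp only [Set.mem_ofPred_eq, PiLp.add_apply, PiLp.smul_apply, this, smul_eq_mul]
        rcases hs.eq_or_lt with h | h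
        · have : t = 1 := by linarith
          subst this; subst h; linarith
        · nlinarith [mul_nonneg ht hy.le]
    · rintro σ τ ⟨h1, h2, h3⟩
      have hW : ptC e {σ, τ} (-1) ∈ W := by
        apply ptW
        rintro a (rfl | rfl) b (rfl | rfl) <;> simp_all [or_comm]
      refine ⟨ptC e {σ, τ} (-1), ⟨hW, ?_⟩, hW, ?_⟩ <;>
      · simp only [Set.mem_ofPred_eq]
        rw [ptC_mem e _ (by simp)]; norm_num
  · ext σ
    constructor
    · intro hσ
      refine ⟨ptC e {σ} (-1), ?_⟩
      have hW : ptC e {σ} (-1) ∈ W :=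
        ptW _ (by rintro a rfl b rfl; exact ⟨hσ, Or.inl subset_rfl⟩)
      ext i
      simp only [Set.mem_ofPred_eq, Set.mem_iUnion]
      constructor
      · intro hi
        exact ⟨σ, ⟨hσ, hi⟩, hW, by simp [ptC_mem e (-1) (Set.mem_singleton σ)]⟩
      · rintro ⟨τ, ⟨h1, h2⟩, -, h3⟩
        by_cases h : τ = σ
        · exact h ▸ h2
        · have : ptC e {σ} (-1) (e τ) = -1 := ptC_not_mem e _ (by simpa using h)
          simp only [Set.mem_ofPred_eq, this] at h3
          linarith
    · rintro ⟨x, rfl⟩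
      by_cases hx : x ∈ W ∧ ∃ a, 0 < x (e a)
      · obtain ⟨hW, hne⟩ := hx
        obtain ⟨m, hm, hmax⟩ := (Set.toFinite {a | 0 < x (e a)}).exists_maximal hne
        have hm : 0 < x (e m) := hm
        have hmC : m ∈ C := (hW m m hm.le hm.le).1
        convert hmC
        ext i
        simp only [Set.mem_ofPred_eq, Set.mem_iUnion]
        constructor
        · rintro ⟨τ, ⟨h1, h2⟩, -, h3⟩
          have h3 : 0 < x (e τ) := h3
          rcases (hW m τ hm.le h3.le).2 with h | h
          · exact hmax h3 h h2
          · exact h h2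
        · intro hi
          exact ⟨m, ⟨hmC, hi⟩, hW, hm⟩
      · convert h0
        ext i
        simp only [Set.mem_ofPred_eq, Set.mem_iUnion, Set.mem_empty_iff_false, iff_false]
        rintro ⟨τ, -, h2, h3⟩
        exact hx ⟨h2, τ, h3⟩

lemma closed_of_conn {n : ℕ} (C : Set (Set (Fin n))) (h0 : ∅ ∈ C) (hC : ConnC C) :
    ∃ d : ℕ, 1 ≤ d ∧ ∃ V : Fin n → Set (EuclideanSpace ℝ (Fin d)),
        (∀ i, IsClosed (V i) ∧ IsPreconnected (V i)) ∧ C = RFCode V := by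
  classical
  let e := Fintype.equivFin (Set (Fin n))
  let W : Fin n → Set (EuclideanSpace ℝ (Fin (Fintype.card (Set (Fin n))))) := fun i =>
    {x | ∀ a b, 0 < x (e a) → 0 < x (e b) → (a ∈ C ∧ (a ⊆ b ∨ b ⊆ a)) ∧ i ∈ a}
  let B : Fin n → Set (Fin n) → Set (EuclideanSpace ℝ (Fin (Fintype.card (Set (Fin n))))) :=
    fun i σ => W i ∩ {x | 1 ≤ x (e σ)}
  have hWo : ∀ i, IsClosed (W i) := by
    intro i
    have : W i = ⋂ a, ⋂ b,
        {x | 0 < x (e a) → 0 < x (e b) → (a ∈ C ∧ (a ⊆ b ∨ b ⊆ a)) ∧ i ∈ a} := by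
      ext x; simp [W]
    rw [this]
    refine isClosed_iInter fun a => isClosed_iInter fun b => ?_
    by_cases h : (a ∈ C ∧ (a ⊆ b ∨ b ⊆ a)) ∧ i ∈ a
    · simp [h]
    · have : {x : EuclideanSpace ℝ (Fin (Fintype.card (Set (Fin n)))) |
          0 < x (e a) → 0 < x (e b) → (a ∈ C ∧ (a ⊆ b ∨ b ⊆ a)) ∧ i ∈ a}
          = {x | x (e a) ≤ 0} ∪ {x | x (e b) ≤ 0} := by
        ext x
        simp only [h, Set.mem_ofPred_eq, Set.mem_union, ← not_lt]
        tauto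
      rw [this]
      exact (isClosed_le (by fun_prop) (by fun_prop)).union
        (isClosed_le (by fun_prop) (by fun_prop))
  have ptW : ∀ i, ∀ S : Set (Set (Fin n)),
      (∀ a ∈ S, ∀ b ∈ S, (a ∈ C ∧ (a ⊆ b ∨ b ⊆ a)) ∧ i ∈ a) → ptC e S 0 ∈ W i := by
    intro i S hS a b ha hb
    by_cases h1 : a ∈ S
    · by_cases h2 : b ∈ S
      · exact hS a h1 b h2
      · rw [ptC_not_mem e _ h2] at hb; linarith
    · rw [ptC_not_mem e _ h1] at ha; linarith
  refine ⟨Fintype.card (Set (Fin n)), Fintype.card_pos,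
    fun i => ⋃ σ ∈ {σ | σ ∈ C ∧ i ∈ σ}, B i σ, fun i => ⟨?_, ?_⟩, ?_⟩
  · exact (Set.toFinite _).isClosed_biUnion fun σ _ =>
      (hWo i).inter (isClosed_le (by fun_prop) (by fun_prop))
  · refine preconn_of hC i (B i) (fun σ => ptC e {σ} 0) ?_ ?_
    · intro σ hσ hi
      refine ⟨⟨ptW i _ ?_, ?_⟩, ?_⟩
      · rintro a rfl b rfl; exact ⟨⟨hσ, Or.inl subset_rfl⟩, hi⟩
      · simp [ptC_mem e 0 (Set.mem_singleton σ)]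
      · rintro y ⟨hyW, hy⟩ s t hs ht hst
        have hy : 1 ≤ y (e σ) := hy
        have key : ∀ a, 0 < (s • ptC e {σ} 0 + t • y) (e a) → 0 < y (e a) := by
          intro a ha
          by_cases h : a = σ
          · subst h; linarith
          · have : ptC e {σ} 0 (e a) = 0 := ptC_not_mem e _ (by simpa using h)
            simp [this] at ha
            by_contra hn
            push Not at hn
            nlinarith
        refine ⟨fun a b ha hb => hyW a b (key a ha) (key b hb), ?_⟩
        have : ptC e {σ} 0 (e σ) = 1 := ptC_mem e _ rfl
        simp only [Set.mem_ofPred_eq, PiLp.add_apply, PiLp.smul_apply, this, smul_eq_mul]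
        nlinarith
    · rintro σ τ ⟨h1, h2, h3⟩
      have hW : ptC e {σ, τ} 0 ∈ W i := by
        apply ptW
        rintro a (rfl | rfl) b (rfl | rfl) <;> simp_all [or_comm]
      refine ⟨ptC e {σ, τ} 0, ⟨hW, ?_⟩, hW, ?_⟩ <;>
      · simp only [Set.mem_ofPred_eq]
        rw [ptC_mem e _ (by simp)]
  · ext σ
    constructor
    · intro hσ
      refine ⟨ptC e {σ} 0, ?_⟩
      ext i
      simp only [Set.mem_ofPred_eq, Set.mem_iUnion]
      constructor
      · intro hi
        have hW : ptC e {σ} 0 ∈ W i :=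
          ptW i _ (by rintro a rfl b rfl; exact ⟨⟨hσ, Or.inl subset_rfl⟩, hi⟩)
        exact ⟨σ, ⟨hσ, hi⟩, hW, by simp [ptC_mem e 0 (Set.mem_singleton σ)]⟩
      · rintro ⟨τ, ⟨h1, h2⟩, -, h3⟩
        by_cases h : τ = σ
        · exact h ▸ h2
        · have : ptC e {σ} 0 (e τ) = 0 := ptC_not_mem e _ (by simpa using h)
          simp only [Set.mem_ofPred_eq, this] at h3
          linarith
    · rintro ⟨x, rfl⟩
      by_cases hx : (∀ a b, 0 < x (e a) → 0 < x (e b) → (a ∈ C ∧ (a ⊆ b ∨ b ⊆ a))) ∧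
          ∃ a, 1 ≤ x (e a)
      · obtain ⟨hW, a0, ha0⟩ := hx
        have ha0' : 0 < x (e a0) := by linarith
        obtain ⟨m, hm, hmin⟩ := (Set.toFinite {a | 0 < x (e a)}).exists_minimal ⟨a0, ha0'⟩
        have hm : 0 < x (e m) := hm
        have hmC : m ∈ C := (hW m m hm hm).1
        have hle : ∀ a, 0 < x (e a) → m ⊆ a := by
          intro a ha
          rcases (hW m a hm ha).2 with h | h
          · exact h
          · exact hmin ha h
        convert hmC
        ext i
        simp only [Set.mem_ofPred_eq, Set.mem_iUnion]
        constructor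
        · rintro ⟨τ, -, h2, -⟩
          exact (h2 m m hm hm).2
        · intro hi
          exact ⟨a0, ⟨(hW a0 a0 ha0' ha0').1, hle _ ha0' hi⟩,
            fun a b ha hb => ⟨hW a b ha hb, hle a ha hi⟩, ha0⟩
      · convert h0
        ext i
        simp only [Set.mem_ofPred_eq, Set.mem_iUnion, Set.mem_empty_iff_false, iff_false]
        rintro ⟨τ, -, h2, h3⟩
        exact hx ⟨fun a b ha hb => (h2 a b ha hb).1, τ, h3⟩

/-- A code with `∅ ∈ 𝒞` is realizable by closed connected sets (in some dimension)
if and only if it is realizable by open connected sets (in some dimension). -/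
theorem realizable_closed_iff_realizable_open {n : ℕ} (hn : 1 ≤ n)
    (C : Set (Set (Fin n))) (hC : (∅ : Set (Fin n)) ∈ C) :
    (∃ d : ℕ, 1 ≤ d ∧ ∃ U : Fin n → Set (EuclideanSpace ℝ (Fin d)),
        (∀ i, IsClosed (U i) ∧ IsPreconnected (U i)) ∧ C = RFCode U) ↔
      (∃ d' : ℕ, 1 ≤ d' ∧ ∃ V : Fin n → Set (EuclideanSpace ℝ (Fin d')),
        (∀ i, IsOpen (V i) ∧ IsPreconnected (V i)) ∧ C = RFCode V) := by
  constructor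
  · rintro ⟨d, -, U, hU, rfl⟩
    exact open_of_conn _ hC (connC_closed U hU)
  · rintro ⟨d, -, U, hU, rfl⟩
    exact closed_of_conn _ hC (connC_open U hU)
end

section
/- Let 𝒞 be the code on 5 neurons consisting of the empty set, all singletons {i} for i ∈ Fin 5, and all two-element subsets {i, j} for distinct i, j ∈ Fin 5. Then there exists a family U : Fin 5 → Set (EuclideanSpace ℝ (Fin 3)) of closed preconnected sets with 𝒞 = 𝒞(U). -/
/-- Example 1: the code on `5` neurons consisting of `∅`, all singletons and all
two-element subsets is realizable by closed preconnected sets in dimension `3`. -/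
theorem example_code5_realizable_dim3 :
    ∃ U : Fin 5 → Set (EuclideanSpace ℝ (Fin 3)),
      (∀ i, IsClosed (U i) ∧ IsPreconnected (U i)) ∧
      {σ : Set (Fin 5) |
        σ = ∅ ∨ (∃ i, σ = {i}) ∨ ∃ i j : Fin 5, i ≠ j ∧ σ = {i, j}} = RFCode U := by
  have key : ∀ i j k : Fin 5, ((k : ℝ) - i) * (k - j) = 0 ↔ k = i ∨ k = j := by
    intro i j k
    rw [mul_eq_zero, sub_eq_zero, sub_eq_zero]
    norm_cast
    rw [Fin.val_inj, Fin.val_inj]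
  refine ⟨fun i => {p | p 2 = 0 ∧ (i : ℝ) ^ 2 - i * p 0 + p 1 = 0}, fun i => ⟨?_, ?_⟩, ?_⟩
  · exact (isClosed_eq (by fun_prop) (by fun_prop)).inter (isClosed_eq (by fun_prop) (by fun_prop))
  · apply Convex.isPreconnected
    rintro p ⟨hp, hp'⟩ q ⟨hq, hq'⟩ a b ha hb hab
    refine ⟨by simp [hp, hq], ?_⟩
    simp only [PiLp.add_apply, PiLp.smul_apply, smul_eq_mul]
    linear_combination a * hp' + b * hq' - (i : ℝ) ^ 2 * hab
  · have pt : ∀ i j : Fin 5, ({i, j} : Set (Fin 5)) ∈ RFCode (fun i : Fin 5 =>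
        {p : EuclideanSpace ℝ (Fin 3) | p 2 = 0 ∧ (i : ℝ) ^ 2 - i * p 0 + p 1 = 0}) := by
      intro i j
      refine ⟨!₂[(i : ℝ) + j, (i : ℝ) * j, 0], ?_⟩
      ext k
      have h := key i j k
      simp only [Set.mem_insert_iff, Set.mem_singleton_iff, Set.mem_setOf_eq]
      rw [← h]
      constructor
      · intro h1
        refine ⟨by simp, ?_⟩
        simp
        linear_combination h1
      · rintro ⟨-, h1⟩
        simp at h1
        linear_combination h1
    ext σ
    constructor
    · rintro (rfl | ⟨i, rfl⟩ | ⟨i, j, -, rfl⟩)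
      · refine ⟨!₂[0, 0, 1], ?_⟩
        ext k
        simp
      · simpa using pt i i
      · exact pt i j
    · rintro ⟨p, rfl⟩
      simp only [Set.mem_setOf_eq]
      rcases Set.eq_empty_or_nonempty
        {i : Fin 5 | p 2 = 0 ∧ (i : ℝ) ^ 2 - i * p 0 + p 1 = 0} with h | ⟨i, h2, hi⟩
      · exact Or.inl h
      · right
        by_cases hj : ∃ j : Fin 5, j ≠ i ∧ (j : ℝ) ^ 2 - j * p 0 + p 1 = 0
        · obtain ⟨j, hne, hj⟩ := hj
          right
          refine ⟨i, j, hne.symm, ?_⟩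
          have hne' : (j : ℝ) - i ≠ 0 := by
            rw [sub_ne_zero]
            norm_cast
            rwa [Fin.val_inj]
          have h0 : p 0 = i + j := by
            apply mul_left_cancel₀ hne'
            linear_combination hi - hj
          ext k
          simp only [Set.mem_insert_iff, Set.mem_singleton_iff, Set.mem_setOf_eq]
          rw [← key i j k]
          rw [h0] at hi ⊢
          constructor
          · rintro ⟨-, h⟩
            linear_combination h - hi
          · intro h
            exact ⟨h2, by linear_combination h + hi⟩
        · left
          refine ⟨i, ?_⟩
          ext k
          simp only [Set.mem_singleton_iff, Set.mem_setOf_eq]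
          constructor
          · rintro ⟨-, h⟩
            by_contra hk
            exact hj ⟨k, hk, h⟩
          · rintro rfl
            exact ⟨h2, hi⟩
end

section
/- Let 𝒞 be the code on 3 neurons given by 𝒞 = {∅, {0}, {1}, {2}, {0,1}, {0,1,2}} (subsets of Fin 3). Then there exists a family U : Fin 3 → Set (EuclideanSpace ℝ (Fin 2)) of closed preconnected sets with 𝒞 = 𝒞(U). -/
/-- half plane `a x ≤ b y` -/
def HP (a b : ℝ) : Set (EuclideanSpace ℝ (Fin 2)) := {p | a * p 0 ≤ b * p 1}

lemma HP_closed (a b : ℝ) : IsClosed (HP a b) := by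
  unfold HP
  exact isClosed_le (by fun_prop) (by fun_prop)

lemma HP_convex (a b : ℝ) : Convex ℝ (HP a b) := by
  intro p hp q hq s t hs ht _
  simp only [HP, Set.mem_setOf_eq, PiLp.add_apply, PiLp.smul_apply, smul_eq_mul] at *
  nlinarith [mul_le_mul_of_nonneg_left hp hs, mul_le_mul_of_nonneg_left hq ht]

/-- Example 2: the code `{∅, {0}, {1}, {2}, {0,1}, {0,1,2}}` on `3` neurons is
realizable by closed preconnected sets in dimension `2`. -/
theorem example_code3_realizable_dim2 :
    ∃ U : Fin 3 → Set (EuclideanSpace ℝ (Fin 2)),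
      (∀ i, IsClosed (U i) ∧ IsPreconnected (U i)) ∧
      ({∅, {0}, {1}, {2}, {0, 1}, {0, 1, 2}} : Set (Set (Fin 3))) = RFCode U := by
  refine ⟨![HP 1 1 ∩ HP (-2) 1, HP 2 1 ∩ HP (-1) 1, HP 0 (-1)], ?_, ?_⟩
  · intro i
    fin_cases i
    · exact ⟨(HP_closed _ _).inter (HP_closed _ _),
        ((HP_convex _ _).inter (HP_convex _ _)).isPreconnected⟩
    · exact ⟨(HP_closed _ _).inter (HP_closed _ _),
        ((HP_convex _ _).inter (HP_convex _ _)).isPreconnected⟩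
    · exact ⟨HP_closed _ _, (HP_convex _ _).isPreconnected⟩
  · ext σ
    simp only [RFCode, Set.mem_insert_iff, Set.mem_singleton_iff, Set.mem_setOf_eq]
    constructor
    · rintro (h | h | h | h | h | h) <;> subst h
      · refine ⟨!₂[2, 1], ?_⟩
        ext i; fin_cases i <;> simp [HP] <;> norm_num
      · refine ⟨!₂[2, 3], ?_⟩
        ext i; fin_cases i <;> simp [HP] <;> norm_num
      · refine ⟨!₂[-2, 3], ?_⟩
        ext i; fin_cases i <;> simp [HP] <;> norm_num
      · refine ⟨!₂[0, -1], ?_⟩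
        ext i; fin_cases i <;> simp [HP] <;> norm_num
      · refine ⟨!₂[0, 1], ?_⟩
        ext i; fin_cases i <;> simp [HP]
      · refine ⟨!₂[0, 0], ?_⟩
        ext i; fin_cases i <;> simp [HP]
    · rintro ⟨p, rfl⟩
      have h02 : p ∈ HP 1 1 ∩ HP (-2) 1 → p ∈ HP 0 (-1) → p ∈ HP 2 1 ∩ HP (-1) 1 := by
        simp only [HP, Set.mem_inter_iff, Set.mem_setOf_eq]
        rintro ⟨h1, h2⟩ h3
        constructor <;> linarith
      have h12 : p ∈ HP 2 1 ∩ HP (-1) 1 → p ∈ HP 0 (-1) → p ∈ HP 1 1 ∩ HP (-2) 1 := by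
        simp only [HP, Set.mem_inter_iff, Set.mem_setOf_eq]
        rintro ⟨h1, h2⟩ h3
        constructor <;> linarith
      generalize HP 1 1 ∩ HP (-2) 1 = A at *
      generalize HP 2 1 ∩ HP (-1) 1 = B at *
      generalize HP 0 (-1) = C at *
      simp only [Set.ext_iff, Fin.forall_fin_succ]
      by_cases ha : p ∈ A <;> by_cases hb : p ∈ B <;> by_cases hc : p ∈ C <;>
        simp_all
end

section
/- Let 𝒞 be the code on 3 neurons given by 𝒞 = {∅, {0}, {1}, {2}, {0,1}, {0,1,2}} (subsets of Fin 3). Then there is no family U : Fin 3 → Set ℝ of closed preconnected subsets of the real line with 𝒞 = 𝒞(U). Hence the minimal embedding dimension of 𝒞 with respect to the family of connected sets equals 2. -/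
/-- The receptive field code of a family of subsets of the real line. -/
def RFCodeLine {n : ℕ} (U : Fin n → Set ℝ) : Set (Set (Fin n)) :=
  {σ | ∃ x : ℝ, σ = {i | x ∈ U i}}

/-- Example 2: the code `{∅, {0}, {1}, {2}, {0,1}, {0,1,2}}` on `3` neurons is not
realizable by closed preconnected subsets of the real line (hence, being realizable in
dimension `2`, its minimal embedding dimension is `2`). -/
theorem example_code3_not_realizable_dim1 :
    ¬ ∃ U : Fin 3 → Set ℝ,
      (∀ i, IsClosed (U i) ∧ IsPreconnected (U i)) ∧
      ({∅, {0}, {1}, {2}, {0, 1}, {0, 1, 2}} : Set (Set (Fin 3))) = RFCodeLine U := by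
  rintro ⟨U, hU, hC⟩
  have key : ∀ i x y z, x ∈ U i → z ∈ U i → x ≤ y → y ≤ z → y ∈ U i :=
    fun i x y z hx hz h1 h2 => (hU i).2.Icc_subset hx hz ⟨h1, h2⟩
  have h0 : ({0} : Set (Fin 3)) ∈ RFCodeLine U := by rw [← hC]; simp
  have h1 : ({1} : Set (Fin 3)) ∈ RFCodeLine U := by rw [← hC]; simp
  have h2 : ({2} : Set (Fin 3)) ∈ RFCodeLine U := by rw [← hC]; simp
  have h3 : ({0, 1, 2} : Set (Fin 3)) ∈ RFCodeLine U := by rw [← hC]; simp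
  obtain ⟨a, ha⟩ := h0
  obtain ⟨b, hb⟩ := h1
  obtain ⟨c, hc⟩ := h2
  obtain ⟨p, hp⟩ := h3
  have ea : ∀ i, a ∈ U i ↔ i = 0 := fun i => (Set.ext_iff.1 ha i).symm
  have eb : ∀ i, b ∈ U i ↔ i = 1 := fun i => (Set.ext_iff.1 hb i).symm
  have ec : ∀ i, c ∈ U i ↔ i = 2 := fun i => (Set.ext_iff.1 hc i).symm
  have ep : ∀ i, p ∈ U i := by
    intro i
    have : i ∈ ({0, 1, 2} : Set (Fin 3)) := by fin_cases i <;> simp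
    rw [hp] at this
    exact this
  -- two points with distinct singleton codewords lie on opposite sides of `p`
  have sep : ∀ i j x y, i ≠ j → (∀ k, x ∈ U k ↔ k = i) → (∀ k, y ∈ U k ↔ k = j) →
      (x < p ∧ p < y) ∨ (y < p ∧ p < x) := by
    intro i j x y hij hx hy
    have hxi := (hx i).2 rfl
    have hyj := (hy j).2 rfl
    have nx : x ∉ U j := fun h => hij ((hx j).1 h).symm
    have ny : y ∉ U i := fun h => hij ((hy i).1 h)
    have n1 : ¬ (x ≤ y ∧ y ≤ p) := fun h => ny (key i x y p hxi (ep i) h.1 h.2)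
    have n2 : ¬ (y ≤ x ∧ x ≤ p) := fun h => nx (key j y x p hyj (ep j) h.1 h.2)
    have n3 : ¬ (p ≤ y ∧ y ≤ x) := fun h => ny (key i p y x (ep i) hxi h.1 h.2)
    have n4 : ¬ (p ≤ x ∧ x ≤ y) := fun h => nx (key j p x y (ep j) hyj h.1 h.2)
    grind
  have s1 := sep 0 1 a b (by decide) ea eb
  have s2 := sep 0 2 a c (by decide) ea ec
  have s3 := sep 1 2 b c (by decide) eb ec
  grind
end
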